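/- Let p ≥ 4 and 1 ≤ a ≤ p−2 be integers and let L ≥ 0. If a is odd then F^{p,1}_{p−a,1}(L) = q^{φ(p−a,p−1)} B^p_{a,1}(L,1), while if a is even then F^{p,1}_{p−a,1}(L) = q^{φ̃(p−a,p−1)+1−a} B^p_{a,1}(L,2), for every real q with 0 < q < 1, where φ(a,b) = (b−a)(b−a+1)/4, φ̃(a,b) = (b−a)(b−a+3)/4, and by convention F^{p,1}_{p−1,b}(L) ≡ F^{p,0}_{1,b}(L). -/

import Mathlib

open Finset

noncomputable section

/-- `(q)_k = ∏_{j=1}^k (1 - q^j)`. -/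
def qPoch (q : ℝ) (k : ℕ) : ℝ := ∏ j ∈ Finset.range k, (1 - q ^ (j + 1))

/-- The Andrews–Baxter `q`-trinomial coefficient `T^n(L,A)`. -/
def qTri (q : ℝ) (n : ℤ) (L : ℕ) (A : ℤ) : ℝ :=
  if |A| ≤ (L : ℤ) then
    ∑ j ∈ Finset.range (L + 1),
      if 0 ≤ (j : ℤ) + A ∧ 0 ≤ (L : ℤ) - 2 * j - A then
        q ^ ((j : ℤ) * ((j : ℤ) + A - n)) * qPoch q L /
          (qPoch q j * qPoch q (((j : ℤ) + A).toNat) * qPoch q (((L : ℤ) - 2 * j - A).toNat))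
      else 0
  else 0

/-- Bosonic polynomial `B^p_{a,b}(L,s)`. -/
def Bpoly (q : ℝ) (p a b s : ℤ) (L : ℕ) : ℝ :=
  ∑' j : ℤ,
    (q ^ (p * (p + 1) * j ^ 2 + j * ((p + 1) * a - p * s)) * qTri q 0 L (2 * p * j + a - b)
      - q ^ ((p * j + a) * ((p + 1) * j + s)) * qTri q 0 L (2 * p * j + a + b))

/-- Bosonic polynomial `B̃^p_{a,b}(L,s)`. -/
def Btpoly (q : ℝ) (p a b s : ℤ) (L : ℕ) : ℝ :=
  ∑' j : ℤ,
    (q ^ (p * (p + 1) * j ^ 2 + j * ((p + 1) * a - p * s)) * qTri q 1 L (2 * p * j + a - b)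
      - q ^ (p * (p + 1) * j ^ 2 + j * ((p + 1) * a + p * (s - 2)) + a * (s - 1) - b)
        * qTri q 1 L (2 * p * j + a + b))

/-- `(q)_∞`. -/
def qPochInf (q : ℝ) : ℝ := ∏' j : ℕ, (1 - q ^ (j + 1))

/-- The matrix `Ĩ_{p-1}`. -/
def ItM (p : ℕ) (i j : Fin (p - 1)) : ℚ :=
  if i.val = 0 then (if j.val = 2 then -1 else 0)
  else if j.val = 0 then (if i.val = 2 then 1 else 0)
  else if i.val = j.val + 1 ∨ j.val = i.val + 1 then 1 else 0

/-- The matrix `C̃_{p-1} = 2·Id - Ĩ_{p-1}`. -/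
def CtM (p : ℕ) (i j : Fin (p - 1)) : ℚ := (if i = j then 2 else 0) - ItM p i j

/-- Unit vector `e_c` (zero if `c` is out of range). -/
def evec (p c : ℕ) : Fin (p - 1) → ℚ := fun i => if i.val = c then 1 else 0

/-- Kronecker delta. -/
def kdel (a b : ℕ) : ℕ := if a = b then 1 else 0

/-- `p̃(n) = 1` if `n` is odd, `0` otherwise. -/
def ptil (n : ℕ) : ℚ := if n % 2 = 1 then 1 else 0

/-- The vector `u^i_{a,b}`. -/
def uvec (p i a b : ℕ) : Fin (p - 1) → ℚ := fun j =>
  (if 1 < a then evec p a j else 0) + (if 1 < b then evec p b j else 0)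
    + ptil (a + kdel a 1 + b + kdel b 1 + (if i = 1 then p - 1 else 0)) * (evec p 1 j - evec p 0 j)

/-- The vector `A^i_{a,b}`. -/
def Avec (p i a b : ℕ) : Fin (p - 1) → ℚ := fun j =>
  (if 1 < b then evec p b j else 0)
    + ptil (a + kdel a 1 + b + kdel b 1 + (if i = 1 then p - 1 else 0)) * evec p 1 j

/-- `q`-binomial coefficient with (possibly non-integral) rational top entry:
it vanishes unless the top is an integer `N` with `0 ≤ m ≤ N`. -/
def qBinQ (q : ℝ) (N : ℚ) (m : ℕ) : ℝ :=
  if N.den = 1 ∧ (m : ℚ) ≤ N then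
    qPoch q N.num.toNat / (qPoch q m * qPoch q (N.num.toNat - m))
  else 0

/-- The quadratic form `Φ(m) = (m·C̃m)/4 - (A·m)/2`. -/
def PhiQ (p : ℕ) (A : Fin (p - 1) → ℚ) (m : Fin (p - 1) → ℕ) : ℚ :=
  (∑ i, ∑ j, (m i : ℚ) * CtM p i j * (m j : ℚ)) / 4 - (∑ j, A j * (m j : ℚ)) / 2

/-- The vector `(½ Ĩ m + L e₀ + ½ u)`. -/
def topVec (p L : ℕ) (u : Fin (p - 1) → ℚ) (m : Fin (p - 1) → ℕ) (i : Fin (p - 1)) : ℚ :=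
  (∑ j, ItM p i j * (m j : ℚ)) / 2 + (L : ℚ) * evec p 0 i + u i / 2

/-- The last component `m_{p-2}`. -/
def mlast (p : ℕ) (m : Fin (p - 1) → ℕ) : ℕ :=
  if h : p - 1 ≠ 0 then m ⟨p - 2, by omega⟩ else 0

/-- The fundamental fermionic form `f^p_k(L; u; A)`. -/
def fFerm (q : ℝ) (p k L : ℕ) (u A : Fin (p - 1) → ℚ) : ℝ :=
  ∑' m : Fin (p - 1) → ℕ,
    if mlast p m % 2 = k % 2 then
      q ^ ((PhiQ p A m : ℝ)) * ∏ i, qBinQ q (topVec p L u m i) (m i)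
    else 0

/-- The fermionic polynomial `F^{p,i}_{a,b}(L)`. -/
def Fpoly (q : ℝ) (p i a b L : ℕ) : ℝ :=
  if b = p - 1 then fFerm q p (1 - i) L (uvec p i a b) (Avec p i a b)
  else fFerm q p i L (uvec p i a b) (Avec p i a b)

def phiR (a b : ℝ) : ℝ := (b - a) * (b - a + 1) / 4

def phitR (a b : ℝ) : ℝ := (b - a) * (b - a + 3) / 4

/-- Virasoro character `χ^{p,p+1}_{r,s}(q)` of the minimal model `M(p,p+1)`. -/
def chiV (p r s : ℤ) (q : ℝ) : ℝ :=
  (∑' j : ℤ, (q ^ (p * (p + 1) * j ^ 2 + j * ((p + 1) * r - p * s))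
      - q ^ ((p * j + r) * ((p + 1) * j + s)))) / qPochInf q

lemma qPoch_succ (q : ℝ) (k : ℕ) : qPoch q (k + 1) = qPoch q k * (1 - q ^ (k + 1)) := by
  unfold qPoch; rw [Finset.prod_range_succ]

lemma qPoch_zero (q : ℝ) : qPoch q 0 = 1 := by simp [qPoch]

lemma one_sub_pow_pos {q : ℝ} (hq0 : 0 < q) (hq1 : q < 1) (k : ℕ) : 0 < 1 - q ^ (k + 1) := by
  have := pow_lt_one₀ hq0.le hq1 (Nat.succ_ne_zero k)
  simpa using this

lemma qPoch_pos {q : ℝ} (hq0 : 0 < q) (hq1 : q < 1) (k : ℕ) : 0 < qPoch q k := by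
  unfold qPoch
  exact Finset.prod_pos fun j _ => one_sub_pow_pos hq0 hq1 j

/-- integer-indexed Gaussian binomial -/
def qb (q : ℝ) (N m : ℤ) : ℝ :=
  if 0 ≤ m ∧ m ≤ N then
    qPoch q N.toNat / (qPoch q m.toNat * qPoch q (N - m).toNat)
  else 0

lemma qb_of_neg (q : ℝ) {N m : ℤ} (h : m < 0) : qb q N m = 0 := by
  unfold qb; rw [if_neg (by omega)]

lemma qb_of_lt (q : ℝ) {N m : ℤ} (h : N < m) : qb q N m = 0 := by
  unfold qb; rw [if_neg (by omega)]

lemma qb_nat (q : ℝ) (a b : ℕ) :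
    qb q ((a : ℤ) + b) a = qPoch q (a + b) / (qPoch q a * qPoch q b) := by
  unfold qb; rw [if_pos (by omega)]
  have h1 : ((a : ℤ) + b).toNat = a + b := by omega
  have h2 : ((a : ℤ) + b - a).toNat = b := by omega
  rw [h1, h2]; simp

lemma qb_symm (q : ℝ) (N m : ℤ) : qb q N (N - m) = qb q N m := by
  unfold qb
  by_cases h : 0 ≤ m ∧ m ≤ N
  · rw [if_pos h, if_pos (by omega), mul_comm]
    have : N - (N - m) = m := by ring
    rw [this]
  · rw [if_neg h, if_neg (by omega)]

lemma qb_symm' (q : ℝ) {N m k : ℤ} (h : m + k = N) : qb q N m = qb q N k := by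
  rw [← qb_symm q N k]; congr 1; omega


lemma qb_zero {q : ℝ} (hq0 : 0 < q) (hq1 : q < 1) {N : ℤ} (h : 0 ≤ N) : qb q N 0 = 1 := by
  lift N to ℕ using h
  have := qb_nat q 0 N
  simp only [Nat.cast_zero, zero_add, qPoch_zero, one_mul] at this
  rw [this, div_self (qPoch_pos hq0 hq1 N).ne']

lemma qb_self {q : ℝ} (hq0 : 0 < q) (hq1 : q < 1) {N : ℤ} (h : 0 ≤ N) : qb q N N = 1 := by
  rw [qb_symm' q (show N + 0 = N by ring), qb_zero hq0 hq1 h]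

lemma qb_pascal {q : ℝ} (hq0 : 0 < q) (hq1 : q < 1) {N : ℤ} (hN : 0 ≤ N) (m : ℤ) :
    qb q (N + 1) m = qb q N (m - 1) + q ^ m * qb q N m := by
  rcases lt_trichotomy m 0 with h | h | h
  · rw [qb_of_neg q h, qb_of_neg q h, qb_of_neg q (by omega)]; simp
  · subst h
    rw [qb_zero hq0 hq1 (by omega), qb_zero hq0 hq1 hN, qb_of_neg q (by omega)]; simp
  · rcases lt_trichotomy m (N + 1) with h' | h' | h'
    · obtain ⟨a, ha⟩ : ∃ a : ℕ, m = a + 1 := ⟨(m - 1).toNat, by omega⟩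
      obtain ⟨b, hb⟩ : ∃ b : ℕ, N = a + 1 + b := ⟨(N - a - 1).toNat, by omega⟩
      subst ha; subst hb
      have e1 := qb_nat q (a + 1) (b + 1)
      have e2 := qb_nat q a (b + 1)
      have e3 := qb_nat q (a + 1) b
      have f1 : ((a : ℤ) + 1 + b + 1) = ((a + 1 : ℕ) : ℤ) + ((b + 1 : ℕ) : ℤ) := by push_cast; ring
      have f2 : ((a : ℤ) + 1 + b) = ((a : ℕ) : ℤ) + ((b + 1 : ℕ) : ℤ) := by push_cast; ring
      have f3 : ((a : ℤ) + 1 + b) = ((a + 1 : ℕ) : ℤ) + ((b : ℕ) : ℤ) := by push_cast; ring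
      have g1 : qb q ((a : ℤ) + 1 + b + 1) ((a : ℤ) + 1)
          = qPoch q (a + 1 + (b + 1)) / (qPoch q (a + 1) * qPoch q (b + 1)) := by
        rw [f1]; exact_mod_cast e1
      have g2 : qb q ((a : ℤ) + 1 + b) ((a : ℤ) + 1 - 1)
          = qPoch q (a + (b + 1)) / (qPoch q a * qPoch q (b + 1)) := by
        rw [f2, add_sub_cancel_right]; exact_mod_cast e2
      have g3 : qb q ((a : ℤ) + 1 + b) ((a : ℤ) + 1)
          = qPoch q (a + 1 + b) / (qPoch q (a + 1) * qPoch q b) := by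
        rw [f3]; exact_mod_cast e3
      rw [g1, g2, g3]
      have h3 : q ^ ((a : ℤ) + 1) = q ^ (a + 1) := by exact_mod_cast zpow_natCast q (a + 1)
      rw [h3]
      have : a + 1 + (b + 1) = a + b + 1 + 1 := by ring
      rw [this]
      have : a + (b + 1) = a + b + 1 := by ring
      rw [this]
      have : a + 1 + b = a + b + 1 := by ring
      rw [this]
      rw [qPoch_succ q (a + b + 1), qPoch_succ q a, qPoch_succ q b]
      have := (qPoch_pos hq0 hq1 a).ne'
      have := (qPoch_pos hq0 hq1 b).ne'
      have := (one_sub_pow_pos hq0 hq1 a).ne'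
      have := (one_sub_pow_pos hq0 hq1 b).ne'
      field_simp
      ring
    · subst h'
      rw [qb_self hq0 hq1 (by omega), qb_of_lt q (show N < N + 1 by omega), add_sub_cancel_right,
        qb_self hq0 hq1 hN]; simp
    · rw [qb_of_lt q (by omega), qb_of_lt q (by omega), qb_of_lt q (by omega)]; simp

lemma qb_pascal' {q : ℝ} (hq0 : 0 < q) (hq1 : q < 1) {N : ℤ} (hN : 0 ≤ N) (m : ℤ) :
    qb q (N + 1) m = q ^ (N + 1 - m) * qb q N (m - 1) + qb q N m := by
  rw [qb_symm' q (show m + (N + 1 - m) = N + 1 by ring), qb_pascal hq0 hq1 hN,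
    qb_symm' q (show (N + 1 - m - 1) + m = N by ring),
    qb_symm' q (show (N + 1 - m) + (m - 1) = N by ring)]
  ring

/-- trinomial revision -/
lemma qb_rev {q : ℝ} (hq0 : 0 < q) (hq1 : q < 1) {Y t : ℤ} (hY : 0 ≤ Y) (ht : 0 ≤ t) (s : ℤ) :
    qb q (Y + t) Y * qb q Y s = qb q (s + t) t * qb q (Y + t) (t + s) := by
  by_cases h1 : s < 0
  · rw [qb_of_neg q h1, qb_of_lt q (show s + t < t by omega)]; simp
  by_cases h2 : Y < s
  · rw [qb_of_lt q h2, qb_of_lt q (show Y + t < t + s by omega)]; simp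
  obtain ⟨a, rfl⟩ : ∃ a : ℕ, s = a := ⟨s.toNat, by omega⟩
  obtain ⟨b, rfl⟩ : ∃ b : ℕ, Y = a + b := ⟨(Y - a).toNat, by omega⟩
  lift t to ℕ using ht
  have e1 := qb_nat q (a + b) t
  have e2 := qb_nat q a b
  have e3 := qb_nat q t a
  have e4 := qb_nat q (t + a) b
  push_cast at e1 e4
  rw [e1, e2, add_comm (a : ℤ) t, e3, show (a : ℤ) + b + t = t + a + b by ring, e4]
  have := (qPoch_pos hq0 hq1 (a+b)).ne'
  have := (qPoch_pos hq0 hq1 (t+a)).ne'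
  have := (qPoch_pos hq0 hq1 a).ne'
  have := (qPoch_pos hq0 hq1 b).ne'
  have := (qPoch_pos hq0 hq1 t).ne'
  have h : t + a + b = a + b + t := by ring
  rw [h]
  field_simp

lemma qb_vdm {q : ℝ} (hq0 : 0 < q) (hq1 : q < 1) (X : ℕ) (Y : ℤ) (hY : 0 ≤ Y) (s : ℤ) :
    ∑ r ∈ range (X + 1), q ^ ((r : ℤ) * (r + s)) * qb q X r * qb q Y (r + s)
      = qb q (X + Y) (X + s) := by
  induction X generalizing s with
  | zero =>
    simp [qb_zero hq0 hq1 (le_refl 0)]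
  | succ X ih =>
    have hX : (0 : ℤ) ≤ X := by positivity
    have e : ∀ r ∈ range (X + 1 + 1), q ^ ((r : ℤ) * (r + s)) * qb q ((X + 1 : ℕ) : ℤ) r * qb q Y (r + s)
        = q ^ ((r : ℤ) * (r + s)) * qb q X r * qb q Y (r + s)
          + q ^ ((r : ℤ) * (r + s)) * q ^ ((X : ℤ) + 1 - r) * qb q X (r - 1) * qb q Y (r + s) := by
      intro r _
      push_cast
      rw [qb_pascal' hq0 hq1 hX]; ring
    rw [sum_congr rfl e, sum_add_distrib, sum_range_succ, sum_range_succ' _ (X + 1), ih s]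
    rw [qb_of_lt q (show (X : ℤ) < ((X + 1 : ℕ) : ℤ) by push_cast; omega)]
    rw [qb_of_neg q (show (((0 : ℕ) : ℤ) - 1) < 0 by simp)]
    have e2 : ∀ r ∈ range (X + 1), q ^ (((r + 1 : ℕ) : ℤ) * (((r + 1 : ℕ) : ℤ) + s)) * q ^ ((X : ℤ) + 1 - ((r + 1 : ℕ) : ℤ)) *
        qb q X (((r + 1 : ℕ) : ℤ) - 1) * qb q Y (((r + 1 : ℕ) : ℤ) + s)
        = q ^ ((X : ℤ) + 1 + s) * (q ^ ((r : ℤ) * (r + (s + 1))) * qb q X r * qb q Y (r + (s + 1))) := by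
      intro r _
      rw [show ((r + 1 : ℕ) : ℤ) - 1 = r by push_cast; ring,
        show ((r + 1 : ℕ) : ℤ) + s = r + (s + 1) by push_cast; ring]
      have hz : q ^ (((r + 1 : ℕ) : ℤ) * (r + (s + 1))) * q ^ ((X : ℤ) + 1 - ((r + 1 : ℕ) : ℤ))
          = q ^ ((X : ℤ) + 1 + s) * q ^ ((r : ℤ) * (r + (s + 1))) := by
        rw [← zpow_add₀ hq0.ne', ← zpow_add₀ hq0.ne']; congr 1; push_cast; ring
      rw [hz]; ring
    rw [sum_congr rfl e2, ← mul_sum, ih (s + 1)]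
    push_cast
    rw [show (X : ℤ) + 1 + Y = X + Y + 1 by ring, qb_pascal hq0 hq1 (by positivity),
      show (X : ℤ) + 1 + s - 1 = X + s by ring, show (X : ℤ) + (s + 1) = X + 1 + s by ring]
    ring

/-- q-Saalschuetz (Burge) summation -/
def saal (q : ℝ) (X : ℕ) (Y s t : ℤ) : ℝ :=
  ∑ r ∈ range (X + 1), q ^ ((r : ℤ) * (r + s)) * qb q (X + Y + t - r) (X + Y) * qb q X r * qb q Y (r + s)

lemma saal_neg {q : ℝ} (X : ℕ) {Y s t : ℤ} (ht : t < 0) : saal q X Y s t = 0 := by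
  unfold saal
  apply sum_eq_zero
  intro r _
  rw [qb_of_lt q (show (X : ℤ) + Y + t - r < X + Y by omega)]; ring

lemma saal_rec {q : ℝ} (hq0 : 0 < q) (hq1 : q < 1) (X : ℕ) {Y t : ℤ} (hY : 0 ≤ Y) (ht : 0 ≤ t) (s : ℤ) :
    saal q (X + 1) Y s t = q ^ ((X : ℤ) + Y + 1) * saal q (X + 1) Y s (t - 1)
      + saal q X Y s t + q ^ ((X : ℤ) + 1 + s) * saal q X Y (s + 1) (t - 1) := by
  have hX : (0 : ℤ) ≤ X := by positivity
  have e : ∀ r ∈ range (X + 1 + 1), q ^ ((r : ℤ) * (r + s)) * qb q (((X + 1 : ℕ) : ℤ) + Y + t - r) (((X + 1 : ℕ) : ℤ) + Y)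
        * qb q ((X + 1 : ℕ) : ℤ) r * qb q Y (r + s)
      = q ^ ((X : ℤ) + Y + 1) * (q ^ ((r : ℤ) * (r + s)) * qb q (((X + 1 : ℕ) : ℤ) + Y + (t - 1) - r) (((X + 1 : ℕ) : ℤ) + Y)
        * qb q ((X + 1 : ℕ) : ℤ) r * qb q Y (r + s))
       + (q ^ ((r : ℤ) * (r + s)) * qb q (X + Y + t - r) (X + Y) * qb q X r * qb q Y (r + s)
        + q ^ ((r : ℤ) * (r + s)) * q ^ ((X : ℤ) + 1 - r) * qb q (X + Y + t - r) (X + Y) * qb q X (r - 1) * qb q Y (r + s)) := by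
    intro r hr
    have hr : (r : ℤ) ≤ X + 1 := by have := mem_range.1 hr; omega
    push_cast
    by_cases h0 : 0 ≤ (X : ℤ) + Y + t - r
    · rw [show (X : ℤ) + 1 + Y + t - r = X + Y + t - r + 1 by ring,
        qb_pascal hq0 hq1 h0, qb_pascal' hq0 hq1 hX,
        show (X : ℤ) + 1 + Y + (t - 1) - r = X + Y + t - r by ring,
        show (X : ℤ) + 1 + Y - 1 = X + Y by ring, show (X : ℤ) + 1 + Y = X + Y + 1 by ring]
      ring
    · rw [qb_of_lt q (show (X : ℤ) + 1 + Y + t - r < X + 1 + Y by omega),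
        qb_of_lt q (show (X : ℤ) + 1 + Y + (t - 1) - r < X + 1 + Y by omega),
        qb_of_lt q (show (X : ℤ) + Y + t - r < X + Y by omega)]
      ring
  unfold saal
  rw [sum_congr rfl e, sum_add_distrib, ← mul_sum, add_assoc (q ^ ((X : ℤ) + Y + 1) * _)]
  congr 1
  rw [sum_add_distrib, sum_range_succ, sum_range_succ' _ (X + 1)]
  rw [qb_of_lt q (show (X : ℤ) < ((X + 1 : ℕ) : ℤ) by push_cast; omega)]
  rw [qb_of_neg q (show (((0 : ℕ) : ℤ) - 1) < 0 by simp)]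
  rw [mul_zero, zero_mul, add_zero, mul_zero, zero_mul, add_zero, mul_sum]
  congr 1
  apply sum_congr rfl
  intro r _
  rw [show ((r + 1 : ℕ) : ℤ) - 1 = r by push_cast; ring,
    show ((r + 1 : ℕ) : ℤ) + s = r + (s + 1) by push_cast; ring]
  have hz : q ^ (((r + 1 : ℕ) : ℤ) * (r + (s + 1))) * q ^ ((X : ℤ) + 1 - ((r + 1 : ℕ) : ℤ))
      = q ^ ((X : ℤ) + 1 + s) * q ^ ((r : ℤ) * (r + (s + 1))) := by
    rw [← zpow_add₀ hq0.ne', ← zpow_add₀ hq0.ne']; congr 1; push_cast; ring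
  rw [hz, show (X : ℤ) + Y + t - ((r + 1 : ℕ) : ℤ) = X + Y + (t - 1) - r by push_cast; ring]; ring

lemma saal_eq {q : ℝ} (hq0 : 0 < q) (hq1 : q < 1) (X : ℕ) {Y : ℤ} (hY : 0 ≤ Y) (s t : ℤ) :
    saal q X Y s t = qb q (X + t + s) t * qb q (Y + t) (t + s) := by
  by_cases ht : t < 0
  · rw [saal_neg X ht, qb_of_neg q ht]; ring
  obtain ⟨t, rfl⟩ : ∃ n : ℕ, t = n := ⟨t.toNat, by omega⟩
  clear ht
  induction X generalizing s t with
  | zero =>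
    unfold saal
    simp only [zero_add, range_one, sum_singleton, Nat.cast_zero, zero_mul, zpow_zero, sub_zero, one_mul]
    rw [qb_zero hq0 hq1 (le_refl 0), mul_one, qb_rev hq0 hq1 hY (by positivity), add_comm s]
  | succ X ihX =>
    have ihX' : ∀ s t : ℤ, saal q X Y s t = qb q (X + t + s) t * qb q (Y + t) (t + s) := by
      intro s t
      by_cases ht : t < 0
      · rw [saal_neg X ht, qb_of_neg q ht]; ring
      obtain ⟨t, rfl⟩ : ∃ n : ℕ, t = n := ⟨t.toNat, by omega⟩
      exact ihX s t
    have key : ∀ t : ℕ, saal q (X + 1) Y s ((t : ℤ) - 1) = qb q (((X + 1 : ℕ) : ℤ) + (t - 1) + s) (t - 1) * qb q (Y + (t - 1)) (t - 1 + s) →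
        saal q (X + 1) Y s t = qb q (((X + 1 : ℕ) : ℤ) + t + s) t * qb q (Y + t) (t + s) := by
      intro t h
      rw [saal_rec hq0 hq1 X hY (by positivity), h, ihX', ihX']
      push_cast
      rw [show (X : ℤ) + 1 + (t - 1) + s = X + t + s by ring, show (X : ℤ) + (t - 1) + (s + 1) = X + t + s by ring,
        show (t : ℤ) - 1 + (s + 1) = t + s by ring, show (X : ℤ) + 1 + t + s = X + t + s + 1 by ring]
      by_cases h1 : (t : ℤ) + s < 0
      · rw [qb_of_neg q h1, qb_of_neg q h1, qb_of_neg q (show (t : ℤ) - 1 + s < 0 by omega)]; ring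
      rw [qb_pascal' hq0 hq1 (show (0 : ℤ) ≤ X + t + s by omega)]
      by_cases h2 : t = 0
      · subst h2
        rw [qb_of_neg q (show ((0 : ℕ) : ℤ) - 1 < 0 by simp)]; ring
      have h3 := qb_pascal' hq0 hq1 (show (0 : ℤ) ≤ Y + (t - 1) by omega) ((t : ℤ) + s)
      rw [show Y + ((t : ℤ) - 1) + 1 = Y + t by ring, show (t : ℤ) + s - 1 = t - 1 + s by ring] at h3
      rw [h3, show (X : ℤ) + t + s + 1 - t = X + 1 + s by ring,
        show (X : ℤ) + Y + 1 = (X + 1 + s) + (Y + t - (t + s)) by ring, zpow_add₀ hq0.ne']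
      ring
    induction t with
    | zero =>
      apply key
      rw [saal_neg _ (by simp), qb_of_neg q (show ((0 : ℕ) : ℤ) - 1 < 0 by simp)]; ring
    | succ t iht =>
      apply key
      push_cast
      rw [show (t : ℤ) + 1 - 1 = t by ring]
      exact_mod_cast iht

/-- `q^{k/4}` -/
def E4 (q : ℝ) (k : ℤ) : ℝ := q ^ ((k : ℝ) / 4)

lemma E4_pos {q : ℝ} (hq0 : 0 < q) (k : ℤ) : 0 < E4 q k := Real.rpow_pos_of_pos hq0 _

lemma E4_add {q : ℝ} (hq0 : 0 < q) (a b : ℤ) : E4 q (a + b) = E4 q a * E4 q b := by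
  unfold E4
  rw [← Real.rpow_add hq0]; congr 1; push_cast; ring

lemma E4_four {q : ℝ} (k : ℤ) : E4 q (4 * k) = q ^ k := by
  unfold E4
  rw [← Real.rpow_intCast]; congr 1; push_cast; ring

lemma E4_zero (q : ℝ) : E4 q 0 = 1 := by simp [E4]

/-- bosonic building block -/
def bt (q : ℝ) (N n A β : ℤ) : ℝ :=
  qb q ((N + A - β) / 2) ((n + A) / 2) * qb q ((N - A + β) / 2) ((n - A) / 2)

/-- Gaussian binomial with half-integral top -/
def qbh (q : ℝ) (T n : ℤ) : ℝ := if T % 2 = 0 then qb q (T / 2) n else 0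

lemma qb_ne {q : ℝ} {N m : ℤ} (h : qb q N m ≠ 0) : 0 ≤ m ∧ m ≤ N := by
  by_contra hc
  exact h (by unfold qb; rw [if_neg hc])

lemma bt_symm (q : ℝ) (N n A β : ℤ) : bt q N n (-A) (-β) = bt q N n A β := by
  unfold bt
  rw [mul_comm, show N - -A + -β = N + A - β by ring, show n - -A = n + A by ring,
    show N + -A - -β = N - A + β by ring, show n + -A = n - A by ring]

lemma burge_aux {q : ℝ} (hq0 : 0 < q) (n : ℕ) (A β : ℤ) (hβ : ((n : ℤ) + A + β) % 2 = 0)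
    (c : ℤ → ℝ) (X : ℕ) (Y : ℤ) (hX : (n : ℤ) + A - β = 2 * X) (hY : (n : ℤ) - A + β = 2 * Y) :
    ∑ m ∈ range (n + 1), (if ((m : ℤ) - A) % 2 = 0 then
        E4 q (((n : ℤ) - m) ^ 2) * c m * bt q n m A β else 0)
      = E4 q (β ^ 2) * ∑ r ∈ range (X + 1), q ^ ((r : ℤ) * (r + β)) * c (n - β - 2 * r) * qb q X r
          * qb q Y (r + β) := by
  rw [mul_sum]
  apply Finset.sum_bij_ne_zero (fun (m : ℕ) _ _ => (((n : ℤ) - m - β) / 2).toNat)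
  · intro m hm hne
    rw [mem_range] at hm ⊢
    split_ifs at hne with hp
    · have hb : bt q n m A β ≠ 0 := fun h => hne (by rw [h, mul_zero])
      unfold bt at hb
      have h1 := qb_ne (left_ne_zero_of_mul hb)
      have h2 := qb_ne (right_ne_zero_of_mul hb)
      omega
    · exact absurd rfl hne
  · intro m hm hne m' hm' hne' h
    split_ifs at hne with hp
    · split_ifs at hne' with hp'
      · have hb : bt q n m A β ≠ 0 := fun h => hne (by rw [h, mul_zero])
        have hb' : bt q n m' A β ≠ 0 := fun h => hne' (by rw [h, mul_zero])
        unfold bt at hb hb'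
        have h1 := qb_ne (left_ne_zero_of_mul hb)
        have h2 := qb_ne (right_ne_zero_of_mul hb)
        have h1' := qb_ne (left_ne_zero_of_mul hb')
        have h2' := qb_ne (right_ne_zero_of_mul hb')
        omega
      · exact absurd rfl hne'
    · exact absurd rfl hne
  · intro r hr hne
    have k1 := qb_ne (right_ne_zero_of_mul (right_ne_zero_of_mul hne))
    have k2 := mem_range.1 hr
    have hm : ((n : ℤ) - β - 2 * r).toNat = (n : ℤ) - β - 2 * r := by omega
    refine ⟨((n : ℤ) - β - 2 * r).toNat, ?_, ?_, ?_⟩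
    · rw [mem_range]; omega
    · rw [hm, if_pos (by omega)]
      intro h
      apply hne
      unfold bt at h
      rw [show ((n : ℤ) + A - β) / 2 = X by omega, show ((n : ℤ) - β - 2 * r + A) / 2 = X - r by omega,
        show ((n : ℤ) - A + β) / 2 = Y by omega, show ((n : ℤ) - β - 2 * r - A) / 2 = Y - (r + β) by omega,
        qb_symm, qb_symm] at h
      have := (E4_pos hq0 (((n : ℤ) - (n - β - 2 * r)) ^ 2)).ne'
      rcases mul_eq_zero.1 h with h | h
      · rcases mul_eq_zero.1 h with h | h
        · exact absurd h this
        · rw [h]; ring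
      · rcases mul_eq_zero.1 h with h | h <;> rw [h] <;> ring
    · rw [hm]; omega
  · intro m hm hne
    split_ifs at hne with hp
    · rw [if_pos hp]
      have hb : bt q n m A β ≠ 0 := fun h => hne (by rw [h, mul_zero])
      unfold bt at hb
      have h1 := qb_ne (left_ne_zero_of_mul hb)
      have h2 := qb_ne (right_ne_zero_of_mul hb)
      generalize hr : (((n : ℤ) - m - β) / 2).toNat = r
      have hm' : (m : ℤ) = n - β - 2 * r := by omega
      rw [hm']
      unfold bt
      rw [show ((n : ℤ) + A - β) / 2 = X by omega, show ((n : ℤ) - β - 2 * r + A) / 2 = X - r by omega,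
        show ((n : ℤ) - A + β) / 2 = Y by omega, show ((n : ℤ) - β - 2 * r - A) / 2 = Y - (r + β) by omega,
        qb_symm, qb_symm, show ((n : ℤ) - (n - β - 2 * r)) ^ 2 = β ^ 2 + 4 * (r * (r + β)) by ring,
        E4_add hq0, E4_four]
      ring
    · exact absurd rfl hne

lemma bt_zero_lhs {q : ℝ} {n m A β : ℤ} (h : n + A - β < 0 ∨ n - A + β < 0) :
    bt q n m A β = 0 := by
  unfold bt
  by_contra hb
  have h1 := qb_ne (left_ne_zero_of_mul hb)
  have h2 := qb_ne (right_ne_zero_of_mul hb)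
  omega

/-- The Burge transform. -/
lemma burge {q : ℝ} (hq0 : 0 < q) (hq1 : q < 1) (N n : ℕ) (A β : ℤ) (hA : ((N : ℤ) - A) % 2 = 0)
    (hβ : ((n : ℤ) + A + β) % 2 = 0) (hs : (0 ≤ A ∧ 0 ≤ β) ∨ (A ≤ 0 ∧ β ≤ 0)) :
    ∑ m ∈ range (n + 1), E4 q (((n : ℤ) - m) ^ 2) * qbh q (N + m) n * bt q n m A β
      = E4 q (β ^ 2) * bt q N n (A + β) β := by
  by_cases h0 : (n : ℤ) + A - β < 0 ∨ (n : ℤ) - A + β < 0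
  · have : bt q N n (A + β) β = 0 := by
      unfold bt
      by_contra hb
      have h1 := qb_ne (left_ne_zero_of_mul hb)
      have h2 := qb_ne (right_ne_zero_of_mul hb)
      omega
    rw [this, mul_zero]
    apply sum_eq_zero
    intro m _
    rw [bt_zero_lhs h0, mul_zero]
  · push Not at h0
    obtain ⟨X, hX⟩ : ∃ X : ℕ, (n : ℤ) + A - β = 2 * X := ⟨(((n : ℤ) + A - β) / 2).toNat, by omega⟩
    obtain ⟨Y, hY⟩ : ∃ Y : ℤ, (n : ℤ) - A + β = 2 * Y := ⟨(((n : ℤ) - A + β) / 2), by omega⟩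
    obtain ⟨t, ht⟩ : ∃ t : ℤ, (N : ℤ) - n - β = 2 * t := ⟨(((N : ℤ) - n - β) / 2), by omega⟩
    have h1 := burge_aux hq0 n A β hβ (fun m => qb q ((N + m) / 2) n) X Y hX hY
    have h2 := saal_eq hq0 hq1 X (show 0 ≤ Y by omega) β t
    have e1 : ∀ m ∈ range (n + 1), E4 q (((n : ℤ) - m) ^ 2) * qbh q (N + m) n * bt q n m A β
        = (if ((m : ℤ) - A) % 2 = 0 then
        E4 q (((n : ℤ) - m) ^ 2) * qb q ((N + m) / 2) n * bt q n m A β else 0) := by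
      intro m _
      unfold qbh
      by_cases hp : ((m : ℤ) - A) % 2 = 0
      · rw [if_pos hp, if_pos (by omega)]
      · rw [if_neg hp, if_neg (by omega)]; ring
    rw [sum_congr rfl e1, h1]
    congr 1
    have e2 : bt q N n (A + β) β = qb q (X + t + β) t * qb q (Y + t) (t + β) := by
      unfold bt
      rw [show ((N : ℤ) + (A + β) - β) / 2 = X + t + β by omega, show ((N : ℤ) - (A + β) + β) / 2 = Y + t by omega]
      congr 1
      · apply qb_symm'; omega
      · apply qb_symm'; omega
    rw [e2, ← h2]
    unfold saal
    apply sum_congr rfl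
    intro r _
    rw [show ((N : ℤ) + (n - β - 2 * r)) / 2 = X + Y + t - r by omega, show (n : ℤ) = X + Y by omega]

lemma burge_inf {q : ℝ} (hq0 : 0 < q) (hq1 : q < 1) (n : ℕ) (A β : ℤ)
    (hβ : ((n : ℤ) + A + β) % 2 = 0) (hs : (0 ≤ A ∧ 0 ≤ β) ∨ (A ≤ 0 ∧ β ≤ 0)) :
    ∑ m ∈ range (n + 1), (if ((m : ℤ) - A) % 2 = 0 then E4 q (((n : ℤ) - m) ^ 2) * bt q n m A β else 0)
      = E4 q (β ^ 2) * qb q n ((n + A + β) / 2) := by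
  by_cases h0 : (n : ℤ) + A - β < 0 ∨ (n : ℤ) - A + β < 0
  · have : qb q n ((n + A + β) / 2) = 0 := by
      by_contra hb
      have h1 := qb_ne hb
      omega
    rw [this, mul_zero]
    apply sum_eq_zero
    intro m _
    rw [bt_zero_lhs h0, mul_zero, ite_self]
  · push Not at h0
    obtain ⟨X, hX⟩ : ∃ X : ℕ, (n : ℤ) + A - β = 2 * X := ⟨(((n : ℤ) + A - β) / 2).toNat, by omega⟩
    obtain ⟨Y, hY⟩ : ∃ Y : ℤ, (n : ℤ) - A + β = 2 * Y := ⟨(((n : ℤ) - A + β) / 2), by omega⟩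
    have h1 := burge_aux hq0 n A β hβ (fun m => 1) X Y hX hY
    have h2 := qb_vdm hq0 hq1 X Y (show 0 ≤ Y by omega) β
    simp only [mul_one] at h1
    rw [h1, h2]
    congr 2
    · omega
    · omega

/-- bosonic summands before the kink -/
def tin (q : ℝ) (P N n j : ℤ) : ℝ :=
  E4 q (4 * P * j ^ 2 + 4 * (P - 1) * j + (P - 2)) *
    (bt q N n (2 * P * j + P - 2) (2 * j + 1) - bt q N n (2 * P * j + P) (2 * j + 1))

/-- bosonic summands after the kink -/
def tout (q : ℝ) (P a N n j : ℤ) : ℝ :=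
  E4 q (4 * P * j ^ 2 + 4 * a * j + (a - 1)) *
    (bt q N n (2 * P * j + a - 1) (2 * j) - bt q N n (2 * P * j + a + 1) (2 * j))

lemma sgn_aux {P j c d : ℤ} (hP : 0 ≤ P) (hc : 0 ≤ c) (hd : 0 ≤ d) (hc' : c ≤ 2 * P)
    (hd' : d ≤ 1) :
    (0 ≤ 2 * P * j + c ∧ 0 ≤ 2 * j + d) ∨ (2 * P * j + c ≤ 0 ∧ 2 * j + d ≤ 0) := by

  by_cases hj : 0 ≤ j
  · left
    exact ⟨by nlinarith [mul_nonneg hP hj], by omega⟩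
  · right
    have : j ≤ -1 := by omega
    exact ⟨by nlinarith [mul_nonneg hP (show 0 ≤ -1 - j by omega)], by omega⟩

lemma tin_burge {q : ℝ} (hq0 : 0 < q) (hq1 : q < 1) (P : ℤ) (hP : 2 ≤ P) (N n : ℕ) (j : ℤ)
    (hN : ((N : ℤ) - P) % 2 = 0) (hn : ((n : ℤ) - P) % 2 = 1) :
    ∑ m ∈ range (n + 1), E4 q (((n : ℤ) - m) ^ 2) * qbh q (N + m) n * tin q P n m j
      = tin q (P + 1) N n j := by
  have hPj : (2 * P * j) % 2 = 0 := by rw [mul_assoc]; simp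
  have b1 := burge hq0 hq1 N n (2 * P * j + P - 2) (2 * j + 1) (by omega) (by omega)
    (by have := sgn_aux (P := P) (j := j) (c := P - 2) (d := 1) (by omega) (by omega) (by omega) (by omega) (by omega)
        rwa [← add_sub_assoc] at this)
  have b2 := burge hq0 hq1 N n (2 * P * j + P) (2 * j + 1) (by omega) (by omega)
    (sgn_aux (by omega) (by omega) (by omega) (by omega) (by omega))
  have e : ∀ m ∈ range (n + 1), E4 q (((n : ℤ) - m) ^ 2) * qbh q (N + m) n * tin q P n m j
      = E4 q (4 * P * j ^ 2 + 4 * (P - 1) * j + (P - 2)) *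
        (E4 q (((n : ℤ) - m) ^ 2) * qbh q (N + m) n * bt q n m (2 * P * j + P - 2) (2 * j + 1)
        - E4 q (((n : ℤ) - m) ^ 2) * qbh q (N + m) n * bt q n m (2 * P * j + P) (2 * j + 1)) := by
    intro m _; unfold tin; ring
  rw [sum_congr rfl e, ← mul_sum, sum_sub_distrib, b1, b2]
  unfold tin
  rw [show 4 * (P + 1) * j ^ 2 + 4 * (P + 1 - 1) * j + (P + 1 - 2)
    = (4 * P * j ^ 2 + 4 * (P - 1) * j + (P - 2)) + (2 * j + 1) ^ 2 by ring,
    E4_add hq0 (4 * P * j ^ 2 + 4 * (P - 1) * j + (P - 2)) ((2 * j + 1) ^ 2),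
    show 2 * P * j + P - 2 + (2 * j + 1) = 2 * (P + 1) * j + (P + 1) - 2 by ring,
    show 2 * P * j + P + (2 * j + 1) = 2 * (P + 1) * j + (P + 1) by ring]
  ring

lemma tout_burge {q : ℝ} (hq0 : 0 < q) (hq1 : q < 1) (P a : ℤ) (ha : 1 ≤ a) (haP : a ≤ P) (N n : ℕ) (j : ℤ)
    (hN : ((N : ℤ) - a) % 2 = 1) (hn : ((n : ℤ) - a) % 2 = 1) :
    ∑ m ∈ range (n + 1), E4 q (((n : ℤ) - m) ^ 2) * qbh q (N + m) n * tout q P a n m j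
      = tout q (P + 1) a N n j := by
  have hPj : (2 * P * j) % 2 = 0 := by rw [mul_assoc]; simp
  have b1 := burge hq0 hq1 N n (2 * P * j + a - 1) (2 * j) (by omega) (by omega)
    (by have := sgn_aux (P := P) (j := j) (c := a - 1) (d := 0) (by omega) (by omega) (by omega) (by omega) (by omega)
        rwa [← add_sub_assoc, add_zero] at this)
  have b2 := burge hq0 hq1 N n (2 * P * j + a + 1) (2 * j) (by omega) (by omega)
    (by have := sgn_aux (P := P) (j := j) (c := a + 1) (d := 0) (by omega) (by omega) (by omega) (by omega) (by omega)
        rwa [← add_assoc, add_zero] at this)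
  have e : ∀ m ∈ range (n + 1), E4 q (((n : ℤ) - m) ^ 2) * qbh q (N + m) n * tout q P a n m j
      = E4 q (4 * P * j ^ 2 + 4 * a * j + (a - 1)) *
        (E4 q (((n : ℤ) - m) ^ 2) * qbh q (N + m) n * bt q n m (2 * P * j + a - 1) (2 * j)
        - E4 q (((n : ℤ) - m) ^ 2) * qbh q (N + m) n * bt q n m (2 * P * j + a + 1) (2 * j)) := by
    intro m _; unfold tout; ring
  rw [sum_congr rfl e, ← mul_sum, sum_sub_distrib, b1, b2]
  unfold tout
  rw [show 4 * (P + 1) * j ^ 2 + 4 * a * j + (a - 1)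
    = (4 * P * j ^ 2 + 4 * a * j + (a - 1)) + (2 * j) ^ 2 by ring,
    E4_add hq0 (4 * P * j ^ 2 + 4 * a * j + (a - 1)) ((2 * j) ^ 2),
    show 2 * P * j + a - 1 + (2 * j) = 2 * (P + 1) * j + a - 1 by ring,
    show 2 * P * j + a + 1 + (2 * j) = 2 * (P + 1) * j + a + 1 by ring]
  ring

lemma tout_burge_inf {q : ℝ} (hq0 : 0 < q) (hq1 : q < 1) (P a : ℤ) (ha : 1 ≤ a) (haP : a ≤ P) (n : ℕ) (j : ℤ)
    (hn : ((n : ℤ) - a) % 2 = 1) :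
    ∑ m ∈ range (n + 1), (if ((m : ℤ) - a) % 2 = 1 then E4 q (((n : ℤ) - m) ^ 2) * tout q P a n m j else 0)
      = E4 q (4 * (P + 1) * j ^ 2 + 4 * a * j + (a - 1)) *
        (qb q n ((n + (2 * (P + 1) * j + a - 1)) / 2) - qb q n ((n + (2 * (P + 1) * j + a + 1)) / 2)) := by
  have hPj : (2 * P * j) % 2 = 0 := by rw [mul_assoc]; simp
  have b1 := burge_inf hq0 hq1 n (2 * P * j + a - 1) (2 * j) (by omega)
    (by have := sgn_aux (P := P) (j := j) (c := a - 1) (d := 0) (by omega) (by omega) (by omega) (by omega) (by omega)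
        rwa [← add_sub_assoc, add_zero] at this)
  have b2 := burge_inf hq0 hq1 n (2 * P * j + a + 1) (2 * j) (by omega)
    (by have := sgn_aux (P := P) (j := j) (c := a + 1) (d := 0) (by omega) (by omega) (by omega) (by omega) (by omega)
        rwa [← add_assoc, add_zero] at this)
  have e : ∀ m ∈ range (n + 1), (if ((m : ℤ) - a) % 2 = 1 then E4 q (((n : ℤ) - m) ^ 2) * tout q P a n m j else 0)
      = E4 q (4 * P * j ^ 2 + 4 * a * j + (a - 1)) *
        ((if ((m : ℤ) - (2 * P * j + a - 1)) % 2 = 0 then E4 q (((n : ℤ) - m) ^ 2) * bt q n m (2 * P * j + a - 1) (2 * j) else 0)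
        - (if ((m : ℤ) - (2 * P * j + a + 1)) % 2 = 0 then E4 q (((n : ℤ) - m) ^ 2) * bt q n m (2 * P * j + a + 1) (2 * j) else 0)) := by
    intro m _; unfold tout
    by_cases hp : ((m : ℤ) - a) % 2 = 1
    · rw [if_pos hp, if_pos (by omega), if_pos (by omega)]; ring
    · rw [if_neg hp, if_neg (by omega), if_neg (by omega)]; ring
  rw [sum_congr rfl e, ← mul_sum, sum_sub_distrib, b1, b2]
  rw [show 4 * (P + 1) * j ^ 2 + 4 * a * j + (a - 1)
    = (4 * P * j ^ 2 + 4 * a * j + (a - 1)) + (2 * j) ^ 2 by ring,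
    E4_add hq0 (4 * P * j ^ 2 + 4 * a * j + (a - 1)) ((2 * j) ^ 2),
    show (n : ℤ) + (2 * P * j + a - 1) + (2 * j) = n + (2 * (P + 1) * j + a - 1) by ring,
    show (n : ℤ) + (2 * P * j + a + 1) + (2 * j) = n + (2 * (P + 1) * j + a + 1) by ring]
  ring

lemma sum_Ico_reflect (J : ℤ) (g : ℤ → ℝ) :
    ∑ j ∈ Ico (-J) J, g (-1 - j) = ∑ j ∈ Ico (-J) J, g j := by
  apply Finset.sum_nbij' (fun j => -1 - j) (fun j => -1 - j)
  · intro j hj; simp only [mem_Ico] at hj ⊢; omega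
  · intro j hj; simp only [mem_Ico] at hj ⊢; omega
  · intro j _; ring
  · intro j _; ring
  · intro j _; rfl

lemma sum_Ico_tele (g : ℤ → ℝ) (a : ℤ) (k : ℕ) :
    ∑ j ∈ Ico a (a + k), (g j - g (j + 1)) = g a - g (a + k) := by
  induction k with
  | zero => simp
  | succ k ih =>
    have : Ico a (a + ((k + 1 : ℕ) : ℤ)) = insert (a + (k : ℤ)) (Ico a (a + k)) := by
      ext x; simp only [mem_Ico, mem_insert]; push_cast; omega
    rw [this, sum_insert (by simp), ih]
    push_cast
    rw [add_assoc]; ring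

lemma kink_diff {q : ℝ} (hq0 : 0 < q) (hq1 : q < 1) {N n A j : ℤ} (hN : (N + n) % 2 = 0)
    (hA : (n + A) % 2 = 0) (h : N - A + 2 * j < 0 → n - A < 0) :
    bt q (N + 1) n A (2 * j + 1) - bt q N n A (2 * j)
      = E4 q (2 * (N - n) + 4 * j + 4) *
        (qb q ((N + A - 2 * j) / 2) ((n + A) / 2) * qb q ((N - A + 2 * j) / 2) ((n - A) / 2 - 1)) := by
  unfold bt
  rw [show (N + 1 + A - (2 * j + 1)) = N + A - 2 * j by ring,
    show (N + 1 - A + (2 * j + 1)) / 2 = (N - A + 2 * j) / 2 + 1 by omega]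
  by_cases h0 : N - A + 2 * j < 0
  · have := h h0
    rw [qb_of_neg q (show (n - A) / 2 < 0 by omega), qb_of_neg q (show (n - A) / 2 < 0 by omega),
      qb_of_neg q (show (n - A) / 2 - 1 < 0 by omega)]; ring
  · rw [qb_pascal' hq0 hq1 (show 0 ≤ (N - A + 2 * j) / 2 by omega),
      show 2 * (N - n) + 4 * j + 4 = 4 * ((N - A + 2 * j) / 2 + 1 - (n - A) / 2) by omega, E4_four]
    ring

lemma kink {q : ℝ} (hq0 : 0 < q) (hq1 : q < 1) {P N n : ℤ} (hP : 2 ≤ P) (hn0 : 0 ≤ n) (hnN : n ≤ N)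
    (hn : (n - P) % 2 = 0) (hN : (N - P) % 2 = 0) (J : ℤ) :
    ∑ j ∈ Ico (-J) J, tin q P (N + 1) n j = ∑ j ∈ Ico (-J) J, tout q P (P - 1) N n j := by
  set h : ℤ → ℝ := fun j => E4 q (4 * P * j ^ 2 + 4 * P * j + (P + 2) + 2 * (N - n)) *
    (qb q ((N + (2 * P * j + P - 2) - 2 * j) / 2) ((n + (2 * P * j + P - 2)) / 2) *
      qb q ((N - (2 * P * j + P - 2) + 2 * j) / 2) ((n - (2 * P * j + P - 2)) / 2 - 1)) with hh
  have key : ∀ j, tin q P (N + 1) n j - tout q P (P - 1) N n j = h j - h (-1 - j) := by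
    intro j
    have hPj : (2 * P * j) % 2 = 0 := by rw [mul_assoc]; simp
    have hc : ∀ A : ℤ, A ≤ 2 * P * j + P → 0 ≤ A - 2 * P * j → N - A + 2 * j < 0 → n - A < 0 := by
      intro A h1 h2 h3
      by_cases hj : 0 ≤ j
      · omega
      · exfalso
        nlinarith [mul_nonneg (show 0 ≤ P - 1 by omega) (show 0 ≤ -1 - j by omega)]
    have d1 := kink_diff hq0 hq1 (N := N) (n := n) (A := 2 * P * j + P - 2) (j := j) (by omega) (by omega)
      (hc _ (by omega) (by omega))
    have d2 := kink_diff hq0 hq1 (N := N) (n := n) (A := 2 * P * j + P) (j := j) (by omega) (by omega)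
      (hc _ (by omega) (by omega))
    have e1 : h j = E4 q (4 * P * j ^ 2 + 4 * (P - 1) * j + (P - 2)) *
        (bt q (N + 1) n (2 * P * j + P - 2) (2 * j + 1) - bt q N n (2 * P * j + P - 2) (2 * j)) := by
      rw [d1, ← mul_assoc, ← E4_add hq0, hh]
      simp only
      congr 2; ring
    have e2 : h (-1 - j) = E4 q (4 * P * j ^ 2 + 4 * (P - 1) * j + (P - 2)) *
        (bt q (N + 1) n (2 * P * j + P) (2 * j + 1) - bt q N n (2 * P * j + P) (2 * j)) := by
      rw [d2, ← mul_assoc, ← E4_add hq0, hh]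
      simp only
      have x1 : 2 * P * (-1 - j) + P - 2 = -(2 * P * j + P) - 2 := by ring
      rw [x1, mul_comm (qb q _ _)]
      congr 2
      · ring
      · congr 1 <;> omega
      · congr 1 <;> omega
    rw [e1, e2]
    unfold tin tout
    rw [show 4 * P * j ^ 2 + 4 * (P - 1) * j + (P - 1 - 1) = 4 * P * j ^ 2 + 4 * (P - 1) * j + (P - 2) by ring,
      show 2 * P * j + (P - 1) - 1 = 2 * P * j + P - 2 by ring, show 2 * P * j + (P - 1) + 1 = 2 * P * j + P by ring]
    ring
  rw [← sub_eq_zero, ← sum_sub_distrib, sum_congr rfl fun j _ => key j, sum_sub_distrib, sum_Ico_reflect,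
    sub_self]

lemma seed1 {q : ℝ} (hq0 : 0 < q) (hq1 : q < 1) (K l : ℕ) (J : ℕ) (hJ : l < J) :
    ∑ j ∈ Ico (-(J : ℤ)) J, tout q 1 1 (2 * (K : ℤ)) (2 * (l : ℤ)) j = if K = 0 ∧ l = 0 then 1 else 0 := by
  have e : ∀ j : ℤ, tout q 1 1 (2 * (K : ℤ)) (2 * (l : ℤ)) j = q ^ (j ^ 2 + j) *
      (qb q K (l + j) * qb q K (l - j) - qb q (K + 1) (l + j + 1) * qb q (K - 1) (l - j - 1)) := by
    intro j
    unfold tout bt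
    rw [show 4 * 1 * j ^ 2 + 4 * 1 * j + (1 - 1) = 4 * (j ^ 2 + j) by ring, E4_four]
    congr 2
    · congr 2 <;> omega
    · congr 2 <;> omega
  simp only [e]
  rcases Nat.eq_zero_or_pos K with hK | hK
  · subst hK
    have e2 : ∀ j : ℤ, qb q (((0 : ℕ) : ℤ) - 1) (l - j - 1) = 0 := by
      intro j; unfold qb; rw [if_neg (by push_cast; omega)]
    simp only [e2, mul_zero, sub_zero, true_and]
    rw [sum_eq_single (0 : ℤ)]
    · by_cases hl : l = 0
      · subst hl; simp [qb_zero hq0 hq1 (le_refl 0)]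
      · rw [if_neg hl, qb_of_lt q (show ((0 : ℕ) : ℤ) < l + 0 by omega)]; ring
    · intro j _ hj
      by_cases h : 0 < (l : ℤ) + j
      · rw [qb_of_lt q (show ((0 : ℕ) : ℤ) < l + j by omega)]; ring
      · rw [qb_of_lt q (show ((0 : ℕ) : ℤ) < l - j by omega)]; ring
    · intro h; exfalso; apply h; simp only [mem_Ico]; omega
  · obtain ⟨K, rfl⟩ : ∃ k, K = k + 1 := ⟨K - 1, by omega⟩
    rw [if_neg (by omega)]
    set g : ℤ → ℝ := fun j => q ^ (j ^ 2 + l) * (qb q (K + 1) (l + j) * qb q K (l - j)) with hg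
    have e3 : ∀ j ∈ Ico (-(J : ℤ)) J, q ^ (j ^ 2 + j) *
      (qb q ((K + 1 : ℕ) : ℤ) (l + j) * qb q ((K + 1 : ℕ) : ℤ) (l - j)
        - qb q (((K + 1 : ℕ) : ℤ) + 1) (l + j + 1) * qb q (((K + 1 : ℕ) : ℤ) - 1) (l - j - 1))
        = g j - g (j + 1) := by
      intro j _
      push_cast
      rw [qb_pascal hq0 hq1 (show (0 : ℤ) ≤ K by positivity) (l - j),
        qb_pascal hq0 hq1 (show (0 : ℤ) ≤ K + 1 by positivity) (l + j + 1), hg]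
      simp only
      rw [show j ^ 2 + (l : ℤ) = (j ^ 2 + j) + (l - j) by ring,
        show (j + 1) ^ 2 + (l : ℤ) = (j ^ 2 + j) + (l + j + 1) by ring, zpow_add₀ hq0.ne' (j ^ 2 + j) ((l : ℤ) - j), zpow_add₀ hq0.ne' (j ^ 2 + j) ((l : ℤ) + j + 1),
        show (l : ℤ) + j + 1 - 1 = l + j by ring, show (K : ℤ) + 1 - 1 = K by ring,
        show (l : ℤ) + (j + 1) = l + j + 1 by ring, show (l : ℤ) - (j + 1) = l - j - 1 by ring]
      ring
    rw [sum_congr rfl e3]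
    have := sum_Ico_tele g (-(J : ℤ)) (2 * J)
    rw [show -(J : ℤ) + ((2 * J : ℕ) : ℤ) = J by push_cast; ring] at this
    rw [this, hg]
    simp only
    rw [qb_of_neg q (show (l : ℤ) + -(J : ℤ) < 0 by omega), qb_of_neg q (show (l : ℤ) - (J : ℤ) < 0 by omega)]
    ring

lemma seed2 {q : ℝ} (hq0 : 0 < q) (hq1 : q < 1) (N n : ℕ) (hN : N % 2 = 0) (hn : n % 2 = 0)
    (J : ℕ) (hJ : n < J) :
    ∑ j ∈ Ico (-(J : ℤ)) J, tout q 2 1 N n j = if n = 0 then 1 else 0 := by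
  have b : ∀ j ∈ Ico (-(J : ℤ)) J, tout q 2 1 N n j = _ := fun j _ =>
    (tout_burge hq0 hq1 1 1 (le_refl 1) (le_refl 1) N n j (by omega) (by omega)).symm
  rw [sum_congr rfl b, sum_comm]
  have c : ∀ m ∈ range (n + 1), ∑ j ∈ Ico (-(J : ℤ)) J, E4 q (((n : ℤ) - m) ^ 2) * qbh q (N + m) n * tout q 1 1 n m j
      = if m = 0 then (if n = 0 then 1 else 0) else 0 := by
    intro m hm
    have hm := mem_range.1 hm
    rw [← mul_sum]
    by_cases hp : m % 2 = 0
    · have := seed1 hq0 hq1 (n / 2) (m / 2) J (by omega)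
      rw [show 2 * ((n / 2 : ℕ) : ℤ) = n by omega, show 2 * ((m / 2 : ℕ) : ℤ) = m by omega] at this
      rw [this]
      by_cases h1 : m = 0
      · by_cases h2 : n = 0
        · subst h1; subst h2
          simp [E4_zero, qbh]
          rw [if_pos (by omega), qb_zero hq0 hq1 (by omega)]
        · rw [if_neg (by omega), if_pos h1, if_neg h2, mul_zero]
      · rw [if_neg (by omega), if_neg h1, mul_zero]
    · rw [if_neg (by omega)]
      unfold qbh
      rw [if_neg (by omega)]; ring
  rw [sum_congr rfl c, sum_ite_eq' (range (n + 1)) 0, if_pos (by simp)]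

/-- The fermionic chain. -/
def Yc (q : ℝ) (a : ℕ) : ℕ → ℕ → ℕ → ℝ
  | 0, N, n => if n = 0 ∧ N % 2 = (if a = 1 then 0 else 1) then 1 else 0
  | r + 1, N, n => ∑ m ∈ range (n + 1), E4 q (((n : ℤ) - m) ^ 2)
      * qbh q ((N : ℤ) + m + (if r + 2 = a then 1 else 0)) n * Yc q a r n m

lemma qbh_ne {q : ℝ} {T n : ℤ} (h : qbh q T n ≠ 0) : T % 2 = 0 ∧ 0 ≤ n ∧ 2 * n ≤ T := by
  unfold qbh at h
  split_ifs at h with hp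
  · have := qb_ne h; omega
  · exact absurd rfl h

lemma Yin_zero {q : ℝ} (a : ℕ) (ha : 2 ≤ a) (r : ℕ) (hr : r + 2 ≤ a) (N n : ℕ)
    (h : Yc q a r N n ≠ 0) : n ≤ N ∧ n % 2 = r % 2 ∧ (N + n) % 2 = 1 := by
  induction r generalizing N n with
  | zero =>
    unfold Yc at h
    rw [if_neg (show ¬ a = 1 by omega)] at h
    split_ifs at h with h1
    · omega
    · exact absurd rfl h
  | succ r ih =>
    unfold Yc at h
    obtain ⟨m, hm, hne⟩ := exists_ne_zero_of_sum_ne_zero h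
    have h1 := ih (by omega) n m (right_ne_zero_of_mul hne)
    have h2 := qbh_ne (right_ne_zero_of_mul (left_ne_zero_of_mul hne))
    rw [if_neg (show ¬ r + 2 = a by omega)] at h2
    omega

lemma Yin_eq {q : ℝ} (hq0 : 0 < q) (hq1 : q < 1) (a : ℕ) (ha : 2 ≤ a) (r : ℕ) (hr : r + 2 ≤ a) (N n : ℕ)
    (J : ℕ) (hJ : n < J) (h1 : n ≤ N) (h2 : n % 2 = r % 2) (h3 : (N + n) % 2 = 1) :
    Yc q a r N n = ∑ j ∈ Ico (-(J : ℤ)) J, tin q ((r : ℤ) + 2) N n j := by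
  induction r generalizing N n with
  | zero =>
    unfold Yc
    rw [if_neg (show ¬ a = 1 by omega)]
    obtain ⟨N, rfl⟩ : ∃ k, N = k + 1 := ⟨N - 1, by omega⟩
    have hk := kink hq0 hq1 (P := 2) (N := N) (n := n) (le_refl 2) (by omega) (by omega) (by omega) (by omega) J
    have hs := seed2 hq0 hq1 N n (by omega) (by omega) J hJ
    push_cast
    rw [hk, show (2 : ℤ) - 1 = 1 by norm_num, hs]
    by_cases h : n = 0
    · rw [if_pos h, if_pos (by omega)]
    · rw [if_neg h, if_neg (by omega)]
  | succ r ih =>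
    unfold Yc
    have b : ∀ j ∈ Ico (-(J : ℤ)) J, tin q (((r + 1 : ℕ) : ℤ) + 2) N n j =
        ∑ m ∈ range (n + 1), E4 q (((n : ℤ) - m) ^ 2) * qbh q (N + m) n * tin q ((r : ℤ) + 2) n m j := fun j _ => by
      have := (tin_burge hq0 hq1 ((r : ℤ) + 2) (by omega) N n j (by omega) (by omega)).symm
      rw [show (r : ℤ) + 2 + 1 = ((r + 1 : ℕ) : ℤ) + 2 by push_cast; ring] at this
      exact this
    rw [sum_congr rfl b, sum_comm]
    apply sum_congr rfl
    intro m hm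
    have hm := mem_range.1 hm
    rw [← mul_sum, if_neg (show ¬ r + 2 = a by omega), add_zero]
    by_cases hp : m % 2 = r % 2
    · rw [ih (by omega) n m (by omega) (by omega) hp (by omega)]
    · have : qbh q ((N : ℤ) + m) n = 0 := by unfold qbh; rw [if_neg (by omega)]
      rw [this]; ring

lemma Yout_zero {q : ℝ} (a : ℕ) (ha : 1 ≤ a) (r : ℕ) (hr : a - 1 ≤ r) (N n : ℕ)
    (h : Yc q a r N n ≠ 0) : n ≤ N ∧ (n + a) % 2 = 1 ∧ (N + a) % 2 = 1 := by
  induction r, hr using Nat.le_induction generalizing N n with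
  | base =>
    rcases Nat.lt_or_ge 1 a with h1 | h1
    · obtain ⟨r, rfl⟩ : ∃ k, a = k + 2 := ⟨a - 2, by omega⟩
      rw [show r + 2 - 1 = r + 1 by omega] at h
      unfold Yc at h
      obtain ⟨m, hm, hne⟩ := exists_ne_zero_of_sum_ne_zero h
      have h1 := Yin_zero (r + 2) (by omega) r (le_refl _) n m (right_ne_zero_of_mul hne)
      have h2 := qbh_ne (right_ne_zero_of_mul (left_ne_zero_of_mul hne))
      rw [if_pos rfl] at h2
      omega
    · obtain rfl : a = 1 := by omega
      change Yc q 1 0 N n ≠ 0 at h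
      unfold Yc at h
      simp only [if_true] at h
      split_ifs at h with h1
      · omega
      · exact absurd rfl h
  | succ r hr ih =>
    unfold Yc at h
    obtain ⟨m, hm, hne⟩ := exists_ne_zero_of_sum_ne_zero h
    have h1 := ih n m (right_ne_zero_of_mul hne)
    have h2 := qbh_ne (right_ne_zero_of_mul (left_ne_zero_of_mul hne))
    rw [if_neg (show ¬ r + 2 = a by omega)] at h2
    omega

lemma Yout_eq {q : ℝ} (hq0 : 0 < q) (hq1 : q < 1) (a : ℕ) (ha : 1 ≤ a) (r : ℕ) (hr : a - 1 ≤ r) (N n : ℕ)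
    (J : ℕ) (hJ : n < J) (h1 : n ≤ N) (h2 : (n + a) % 2 = 1) (h3 : (N + a) % 2 = 1) :
    Yc q a r N n = ∑ j ∈ Ico (-(J : ℤ)) J, tout q ((r : ℤ) + 2) a N n j := by
  induction r, hr using Nat.le_induction generalizing N n with
  | base =>
    rcases Nat.lt_or_ge 1 a with ha1 | ha1
    · obtain ⟨r, rfl⟩ : ∃ k, a = k + 2 := ⟨a - 2, by omega⟩
      rw [show r + 2 - 1 = r + 1 by omega]
      have hk := kink hq0 hq1 (P := (r : ℤ) + 3) (N := N) (n := n) (by omega) (by omega) (by omega)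
        (by omega) (by omega) J
      rw [show ((r + 1 : ℕ) : ℤ) + 2 = r + 3 by push_cast; ring,
        show ((r + 2 : ℕ) : ℤ) = r + 3 - 1 by push_cast; ring, ← hk]
      unfold Yc
      have b : ∀ j ∈ Ico (-(J : ℤ)) J, tin q ((r : ℤ) + 3) ((N : ℤ) + 1) n j =
          ∑ m ∈ range (n + 1), E4 q (((n : ℤ) - m) ^ 2) * qbh q ((N : ℤ) + 1 + m) n * tin q ((r : ℤ) + 2) n m j := fun j _ => by
        have := (tin_burge hq0 hq1 ((r : ℤ) + 2) (by omega) (N + 1) n j (by omega) (by omega)).symm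
        rw [show (r : ℤ) + 2 + 1 = (r : ℤ) + 3 by ring] at this
        push_cast at this
        exact this
      rw [sum_congr rfl b, sum_comm]
      apply sum_congr rfl
      intro m hm
      have hm := mem_range.1 hm
      rw [← mul_sum, if_pos rfl, show (N : ℤ) + m + 1 = N + 1 + m by ring]
      by_cases hp : m % 2 = r % 2
      · rw [Yin_eq hq0 hq1 (r + 2) (by omega) r (le_refl _) n m J (by omega) (by omega) hp (by omega)]
      · have : qbh q ((N : ℤ) + 1 + m) n = 0 := by unfold qbh; rw [if_neg (by omega)]
        rw [this]; ring
    · obtain rfl : a = 1 := by omega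
      have hs := seed2 hq0 hq1 N n (by omega) (by omega) J hJ
      simp only [Nat.sub_self, Nat.cast_zero, zero_add, Nat.cast_one]
      rw [hs]
      unfold Yc
      simp only [if_true]
      by_cases h : n = 0
      · rw [if_pos h, if_pos (by omega)]
      · rw [if_neg h, if_neg (by omega)]
  | succ r hr ih =>
    unfold Yc
    have b : ∀ j ∈ Ico (-(J : ℤ)) J, tout q (((r + 1 : ℕ) : ℤ) + 2) a N n j =
        ∑ m ∈ range (n + 1), E4 q (((n : ℤ) - m) ^ 2) * qbh q (N + m) n * tout q ((r : ℤ) + 2) a n m j := fun j _ => by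
      have := (tout_burge hq0 hq1 ((r : ℤ) + 2) a (by omega) (by omega) N n j (by omega) (by omega)).symm
      rw [show (r : ℤ) + 2 + 1 = ((r + 1 : ℕ) : ℤ) + 2 by push_cast; ring] at this
      exact this
    rw [sum_congr rfl b, sum_comm]
    apply sum_congr rfl
    intro m hm
    have hm := mem_range.1 hm
    rw [← mul_sum, if_neg (show ¬ r + 2 = a by omega), add_zero]
    by_cases hp : (m + a) % 2 = 1
    · rw [ih n m (by omega) (by omega) hp (by omega)]
    · have : qbh q ((N : ℤ) + m) n = 0 := by unfold qbh; rw [if_neg (by omega)]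
      rw [this]; ring

lemma Yinf {q : ℝ} (hq0 : 0 < q) (hq1 : q < 1) (a : ℕ) (ha : 1 ≤ a) (r : ℕ) (hr : a - 1 ≤ r) (n : ℕ)
    (J : ℕ) (hJ : n < J) :
    ∑ m ∈ range (n + 1), E4 q (((n : ℤ) - m) ^ 2) * Yc q a r n m
      = if (n + a) % 2 = 1 then ∑ j ∈ Ico (-(J : ℤ)) J,
        E4 q (4 * ((r : ℤ) + 3) * j ^ 2 + 4 * a * j + (a - 1)) *
        (qb q n ((n + (2 * ((r : ℤ) + 3) * j + a - 1)) / 2) - qb q n ((n + (2 * ((r : ℤ) + 3) * j + a + 1)) / 2))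
      else 0 := by
  by_cases hp : (n + a) % 2 = 1
  · rw [if_pos hp]
    have b : ∀ j ∈ Ico (-(J : ℤ)) J, E4 q (4 * ((r : ℤ) + 3) * j ^ 2 + 4 * a * j + (a - 1)) *
        (qb q n ((n + (2 * ((r : ℤ) + 3) * j + a - 1)) / 2) - qb q n ((n + (2 * ((r : ℤ) + 3) * j + a + 1)) / 2)) =
        ∑ m ∈ range (n + 1), (if ((m : ℤ) - a) % 2 = 1 then E4 q (((n : ℤ) - m) ^ 2) * tout q ((r : ℤ) + 2) a n m j else 0) := fun j _ => by
      have := (tout_burge_inf hq0 hq1 ((r : ℤ) + 2) a (by omega) (by omega) n j (by omega)).symm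
      rw [show (r : ℤ) + 2 + 1 = r + 3 by ring] at this
      exact this
    rw [sum_congr rfl b, sum_comm]
    apply sum_congr rfl
    intro m hm
    have hm := mem_range.1 hm
    by_cases hp' : (m + a) % 2 = 1
    · simp only [if_pos (show ((m : ℤ) - a) % 2 = 1 by omega)]
      rw [← mul_sum, Yout_eq hq0 hq1 a ha r hr n m J (by omega) (by omega) hp' hp]
    · simp only [if_neg (show ¬ ((m : ℤ) - a) % 2 = 1 by omega)]
      by_cases hY : Yc q a r n m = 0
      · rw [hY]; simp
      · have := Yout_zero a ha r hr n m hY; omega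
  · rw [if_neg hp]
    apply sum_eq_zero
    intro m _
    by_cases hY : Yc q a r n m = 0
    · rw [hY]; simp
    · have := Yout_zero a ha r hr n m hY; omega

lemma qTri_eq {q : ℝ} (hq0 : 0 < q) (hq1 : q < 1) (L : ℕ) (A : ℤ) :
    qTri q 0 L A = ∑ n ∈ range (L + 1),
      if ((n : ℤ) + A) % 2 = 0 then E4 q ((n : ℤ) ^ 2 - A ^ 2) * qb q L n * qb q n (((n : ℤ) + A) / 2) else 0 := by
  unfold qTri
  split_ifs with hA
  · rw [← sum_filter, ← sum_filter]
    have hz : ∑ n ∈ (range (L + 1)).filter (fun n : ℕ => ((n : ℤ) + A) % 2 = 0),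
        E4 q ((n : ℤ) ^ 2 - A ^ 2) * qb q L n * qb q n (((n : ℤ) + A) / 2)
        = ∑ n ∈ (range (L + 1)).filter (fun n : ℕ => ((n : ℤ) + A) % 2 = 0 ∧ |A| ≤ (n : ℤ)),
        E4 q ((n : ℤ) ^ 2 - A ^ 2) * qb q L n * qb q n (((n : ℤ) + A) / 2) := by
      symm
      apply sum_subset
      · intro n; simp only [mem_filter]; tauto
      · intro n h1 h2
        simp only [mem_filter] at h1 h2
        have h3 : ¬ |A| ≤ (n : ℤ) := fun h => h2 ⟨h1.1, h1.2, h⟩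
        have : qb q n (((n : ℤ) + A) / 2) = 0 := by
          by_contra hc
          have := qb_ne hc
          rw [abs_le] at h3
          omega
        rw [this, mul_zero]
    rw [hz]
    apply sum_nbij' (fun j : ℕ => (2 * (j : ℤ) + A).toNat) (fun n : ℕ => (((n : ℤ) - A) / 2).toNat)
    · intro j hj
      simp only [mem_filter, mem_range, abs_le] at hj ⊢
      omega
    · intro j hj
      simp only [mem_filter, mem_range, abs_le] at hj ⊢
      omega
    · intro j hj
      simp only [mem_filter, mem_range, abs_le] at hj ⊢
      omega
    · intro j hj
      simp only [mem_filter, mem_range, abs_le] at hj ⊢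
      omega
    · intro j hj
      simp only [mem_filter, mem_range] at hj
      obtain ⟨hj0, hj1, hj2⟩ := hj
      obtain ⟨k, hk⟩ : ∃ k : ℕ, (j : ℤ) + A = k := ⟨((j : ℤ) + A).toNat, by omega⟩
      obtain ⟨M, hM⟩ : ∃ M : ℕ, (L : ℤ) - 2 * j - A = M := ⟨((L : ℤ) - 2 * j - A).toNat, by omega⟩
      have e1 : (2 * (j : ℤ) + A).toNat = j + k := by omega
      rw [hk, hM, e1]
      have e2 : ((((j + k : ℕ) : ℤ)) + A) / 2 = k := by push_cast; omega
      have e3 : (L : ℤ) = ((j + k : ℕ) : ℤ) + M := by push_cast; omega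
      have e4 : L = j + k + M := by omega
      have e5 : (((j + k : ℕ) : ℤ)) = k + j := by push_cast; ring
      rw [e2, e3, qb_nat, e5, qb_nat, show ((k : ℤ) + j) ^ 2 - A ^ 2 = 4 * ((j : ℤ) * ((j : ℤ) + A - 0)) by
        rw [show A = (k : ℤ) - j by omega]; ring, E4_four, show (j : ℤ) + A - 0 = j + A by ring, hk, e4, add_comm k j]
      have p1 := (qPoch_pos hq0 hq1 j).ne'
      have p2 := (qPoch_pos hq0 hq1 k).ne'
      have p3 := (qPoch_pos hq0 hq1 M).ne'
      have p4 := (qPoch_pos hq0 hq1 (j + k)).ne'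
      simp only [Int.toNat_natCast]
      field_simp
      rw [sub_zero, mul_comm]
  · symm
    apply sum_eq_zero
    intro n hn
    have hn := mem_range.1 hn
    split_ifs
    · have : qb q n (((n : ℤ) + A) / 2) = 0 := by
        by_contra hc
        have := qb_ne hc
        rw [abs_le] at hA
        omega
      rw [this, mul_zero]
    · rfl

lemma qb_rel {q : ℝ} (hq0 : 0 < q) (hq1 : q < 1) {n : ℤ} (hn : 0 ≤ n) (K : ℤ) :
    q ^ (n - K) * qb q n K - q ^ (K + 1) * qb q n (K + 1) = qb q n K - qb q n (K + 1) := by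
  have h1 := qb_pascal hq0 hq1 hn (K + 1)
  have h2 := qb_pascal' hq0 hq1 hn (K + 1)
  rw [show K + 1 - 1 = K by ring] at h1 h2
  rw [show n + 1 - (K + 1) = n - K by ring] at h2
  linarith

/-- Common normal form of both sides. -/
def Sform (q : ℝ) (p a e : ℤ) (L : ℕ) (J : ℤ) : ℝ :=
  ∑ n ∈ range (L + 1), qb q L n * E4 q ((n : ℤ) ^ 2 - 2 * n * e) *
    (if ((n : ℤ) + a) % 2 = 1 then ∑ j ∈ Ico (-J) J,
        E4 q (4 * p * j ^ 2 + 4 * a * j + (a - 1)) *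
        (qb q n ((n + (2 * p * j + a - 1)) / 2) - qb q n ((n + (2 * p * j + a + 1)) / 2))
      else 0)

lemma bos_sum {q : ℝ} (p a s e c : ℤ) (hp : 4 ≤ p) (ha : 1 ≤ a) (hap : a ≤ p - 2)
    (L : ℕ) (J : ℤ) (hJ : L + 2 ≤ J)
    (h : ∀ j : ℤ, E4 q c * (q ^ (p * (p + 1) * j ^ 2 + j * ((p + 1) * a - p * s)) * qTri q 0 L (2 * p * j + a - 1)
      - q ^ ((p * j + a) * ((p + 1) * j + s)) * qTri q 0 L (2 * p * j + a + 1)) =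
      ∑ n ∈ range (L + 1), qb q L n * E4 q ((n : ℤ) ^ 2 - 2 * n * e) *
    (if ((n : ℤ) + a) % 2 = 1 then
        E4 q (4 * p * j ^ 2 + 4 * a * j + (a - 1)) *
        (qb q n ((n + (2 * p * j + a - 1)) / 2) - qb q n ((n + (2 * p * j + a + 1)) / 2))
      else 0)) :
    E4 q c * Bpoly q p a 1 s L = Sform q p a e L J := by
  unfold Bpoly
  rw [tsum_eq_sum (s := Ico (-J) J)]
  · rw [mul_sum, sum_congr rfl fun j _ => h j, sum_comm]
    unfold Sform
    apply sum_congr rfl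
    intro n _
    rw [← mul_sum]
    congr 1
    split_ifs <;> simp
  · intro j hj
    simp only [mem_Ico, not_and, not_lt] at hj
    have hb : ∀ d : ℤ, -1 ≤ d → d ≤ 1 → qTri q 0 L (2 * p * j + a + d) = 0 := by
      intro d h1 h2
      unfold qTri
      rw [if_neg]
      rw [abs_le]
      rintro ⟨h3, h4⟩
      by_cases hj0 : 0 ≤ j
      · have : J ≤ j := hj (by omega)
        nlinarith
      · have : j < -J := by by_contra hc; exact absurd (hj (by omega)) (by omega)
        nlinarith
    have h1 := hb (-1) (by omega) (by omega)
    have h2 := hb 1 (by omega) (by omega)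
    rw [show 2 * p * j + a + -1 = 2 * p * j + a - 1 by ring] at h1
    rw [h1, h2]; ring

lemma bos_gen {q : ℝ} (hq0 : 0 < q) (hq1 : q < 1) (p a s c : ℤ) (L : ℕ) (j : ℤ) :
    E4 q c * (q ^ (p * (p + 1) * j ^ 2 + j * ((p + 1) * a - p * s)) * qTri q 0 L (2 * p * j + a - 1)
      - q ^ ((p * j + a) * ((p + 1) * j + s)) * qTri q 0 L (2 * p * j + a + 1)) =
      ∑ n ∈ range (L + 1), qb q L n *
    (if ((n : ℤ) + a) % 2 = 1 then
        E4 q (c + n ^ 2 + 4 * p * j ^ 2 + 4 * j * (a + p - p * s) - (a - 1) ^ 2) * qb q n ((n + (2 * p * j + a - 1)) / 2)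
         - E4 q (c + n ^ 2 + 4 * p * j ^ 2 + 4 * j * (p * s + a - p) + 4 * a * s - (a + 1) ^ 2) *
           qb q n ((n + (2 * p * j + a + 1)) / 2)
      else 0) := by
  rw [qTri_eq hq0 hq1, qTri_eq hq0 hq1, mul_sum, mul_sum, ← sum_sub_distrib, mul_sum]
  apply sum_congr rfl
  intro n _
  have hPj : (2 * p * j) % 2 = 0 := by rw [mul_assoc]; simp
  by_cases hn : ((n : ℤ) + a) % 2 = 1
  · rw [if_pos hn, if_pos (by omega), if_pos (by omega), ← E4_four, ← E4_four,
      show c + (n : ℤ) ^ 2 + 4 * p * j ^ 2 + 4 * j * (a + p - p * s) - (a - 1) ^ 2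
      = c + (4 * (p * (p + 1) * j ^ 2 + j * ((p + 1) * a - p * s)) + ((n : ℤ) ^ 2 - (2 * p * j + a - 1) ^ 2)) by ring,
      show c + (n : ℤ) ^ 2 + 4 * p * j ^ 2 + 4 * j * (p * s + a - p) + 4 * a * s - (a + 1) ^ 2
      = c + (4 * ((p * j + a) * ((p + 1) * j + s)) + ((n : ℤ) ^ 2 - (2 * p * j + a + 1) ^ 2)) by ring,
      E4_add hq0 c, E4_add hq0 c, E4_add hq0 (4 * _), E4_add hq0 (4 * _)]
    ring
  · rw [if_neg hn, if_neg (by omega), if_neg (by omega)]; ring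

lemma bos_odd {q : ℝ} (hq0 : 0 < q) (hq1 : q < 1) (p a : ℤ) (hp : 4 ≤ p) (ha : 1 ≤ a) (hap : a ≤ p - 2)
    (L : ℕ) (J : ℤ) (hJ : L + 2 ≤ J) :
    E4 q ((a - 1) * a) * Bpoly q p a 1 1 L = Sform q p a 0 L J := by
  apply bos_sum p a 1 0 _ hp ha hap L J hJ
  intro j
  rw [bos_gen hq0 hq1]
  apply sum_congr rfl
  intro n _
  rw [mul_assoc (qb q _ _)]
  congr 1
  split_ifs
  · rw [← mul_assoc, ← E4_add hq0, mul_sub (E4 q _)]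
    congr 3 <;> ring
  · ring

lemma bos_even {q : ℝ} (hq0 : 0 < q) (hq1 : q < 1) (p a : ℤ) (hp : 4 ≤ p) (ha : 1 ≤ a) (hap : a ≤ p - 2)
    (L : ℕ) (J : ℤ) (hJ : L + 2 ≤ J) :
    E4 q ((a - 1) * (a - 2)) * Bpoly q p a 1 2 L = Sform q p a 1 L J := by
  apply bos_sum p a 2 1 _ hp ha hap L J hJ
  intro j
  rw [bos_gen hq0 hq1]
  apply sum_congr rfl
  intro n _
  rw [mul_assoc (qb q _ _)]
  congr 1
  have hPj : (2 * p * j) % 2 = 0 := by rw [mul_assoc]; simp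
  split_ifs
  · rw [← mul_assoc, ← E4_add hq0]
    have h := qb_rel hq0 hq1 (show (0 : ℤ) ≤ n by positivity) (((n : ℤ) + (2 * p * j + a - 1)) / 2)
    rw [show ((n : ℤ) + (2 * p * j + a + 1)) / 2 = ((n : ℤ) + (2 * p * j + a - 1)) / 2 + 1 by omega, ← h,
      ← E4_four, ← E4_four, mul_sub (E4 q _), ← mul_assoc, ← mul_assoc, ← E4_add hq0, ← E4_add hq0]
    obtain ⟨K, hK⟩ : ∃ K, (n : ℤ) + (2 * p * j + a - 1) = 2 * K := ⟨((n : ℤ) + (2 * p * j + a - 1)) / 2, by omega⟩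
    rw [hK, show 2 * K / 2 = K by omega]
    have h1 : 2 * K = n + (2 * p * j + a - 1) := hK.symm
    congr 3
    · linear_combination 2 * h1
    · linear_combination (-2) * h1
  · ring

/-- extension by zero -/
def ext0 {K : ℕ} (m : Fin K → ℕ) : ℕ → ℕ := fun i => if h : i < K then m ⟨i, h⟩ else 0

lemma ext0_fin {K : ℕ} (m : Fin K → ℕ) (i : Fin K) : ext0 m i.val = m i := by
  unfold ext0; rw [dif_pos i.isLt]

lemma ext0_ge {K : ℕ} (m : Fin K → ℕ) {i : ℕ} (h : K ≤ i) : ext0 m i = 0 := by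
  unfold ext0; rw [dif_neg (by omega)]

lemma ext0_cons_zero {K : ℕ} (n : ℕ) (t : Fin K → ℕ) : ext0 (Fin.cons n t : Fin (K + 1) → ℕ) 0 = n := by
  unfold ext0; rw [dif_pos (by omega)]; rfl

lemma ext0_cons_succ {K : ℕ} (n : ℕ) (t : Fin K → ℕ) (i : ℕ) :
    ext0 (Fin.cons n t : Fin (K + 1) → ℕ) (i + 1) = ext0 t i := by
  unfold ext0
  by_cases h : i < K
  · rw [dif_pos h, dif_pos (by omega)]; rfl
  · rw [dif_neg h, dif_neg (by omega)]

lemma hasSum_cons {r : ℕ} (g : (Fin (r + 1) → ℕ) → ℝ) (h : ℕ → ℝ) (K : ℕ)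
    (H : ∀ n, HasSum (fun t : Fin r → ℕ => g (Fin.cons n t)) (h n))
    (hz : ∀ n, K ≤ n → ∀ t : Fin r → ℕ, g (Fin.cons n t) = 0) :
    HasSum g (∑ n ∈ range K, h n) := by
  have h1 : ∀ n ∈ range K, HasSum (fun m : Fin (r + 1) → ℕ => if m 0 = n then g m else 0) (h n) := by
    intro n _
    have hi : Function.Injective (fun t : Fin r → ℕ => (Fin.cons n t : Fin (r + 1) → ℕ)) :=
      Fin.cons_right_injective (α := fun _ => ℕ) n
    rw [← hi.hasSum_iff]
    · convert H n using 2 with t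
      simp
    · intro m hm
      rw [if_neg]
      intro h0
      apply hm
      exact ⟨Fin.tail m, by rw [← h0]; exact Fin.cons_self_tail m⟩
  have h2 := hasSum_sum h1
  convert h2 using 2 with m
  rw [sum_ite_eq]
  split_ifs with h3
  · rfl
  · rw [mem_range, not_lt] at h3
    have := hz (m 0) h3 (Fin.tail m)
    rwa [Fin.cons_self_tail] at this

/-- pointwise chain weight -/
def Vw (q : ℝ) (a : ℕ) : ℕ → ℕ → (ℕ → ℕ) → ℝ
  | 0, N, f => E4 q ((f 0 : ℤ) ^ 2) * qbh q ((N : ℤ) + (if 2 = a then 1 else 0)) (f 0) *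
      (if f 0 % 2 = (if a = 1 then 0 else 1) then 1 else 0)
  | r + 1, N, f => E4 q (((f 0 : ℤ) - f 1) ^ 2) * qbh q ((N : ℤ) + f 1 + (if r + 3 = a then 1 else 0)) (f 0) *
      Vw q a r (f 0) (fun i => f (i + 1))

lemma Vw_ne {q : ℝ} (a : ℕ) (ha : 1 ≤ a) (r N : ℕ) (f : ℕ → ℕ) (h : Vw q a r N f ≠ 0) :
    f 0 ≤ N ∧ ((r + 3 ≤ a → f 0 % 2 = (r + 1) % 2 ∧ (N + f 0) % 2 = 1) ∧
      (a ≤ r + 2 → (f 0 + a) % 2 = 1 ∧ (N + a) % 2 = 1)) := by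
  induction r generalizing N f with
  | zero =>
    unfold Vw at h
    have h1 := right_ne_zero_of_mul h
    have h2 := qbh_ne (right_ne_zero_of_mul (left_ne_zero_of_mul h))
    have h3 : f 0 % 2 = (if a = 1 then 0 else 1) := by
      by_contra hc; rw [if_neg hc] at h1; exact h1 rfl
    split_ifs at h2 h3 <;> omega
  | succ r ih =>
    unfold Vw at h
    have h1 := ih _ _ (right_ne_zero_of_mul h)
    have h2 := qbh_ne (right_ne_zero_of_mul (left_ne_zero_of_mul h))
    simp only [zero_add] at h1
    split_ifs at h2 <;> omega

lemma Vw_hasSum {q : ℝ} (a : ℕ) (ha : 1 ≤ a) (r N n : ℕ) :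
    HasSum (fun t : Fin r → ℕ => Vw q a r N (ext0 (Fin.cons n t : Fin (r + 1) → ℕ))) (Yc q a (r + 1) N n) := by
  induction r generalizing N n with
  | zero =>
    have : ∀ t : Fin 0 → ℕ, Vw q a 0 N (ext0 (Fin.cons n t : Fin (0 + 1) → ℕ)) = Yc q a (0 + 1) N n := by
      intro t
      unfold Vw
      rw [ext0_cons_zero]
      unfold Yc
      rw [sum_range_succ', sum_eq_zero]
      · unfold Yc
        simp
      · intro m _
        unfold Yc
        simp
    simp only [this]
    exact hasSum_unique _
  | succ r ih =>
    unfold Yc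
    apply hasSum_cons
    · intro m
      have := (ih n m).mul_left (E4 q (((n : ℤ) - m) ^ 2) * qbh q ((N : ℤ) + m + (if r + 1 + 2 = a then 1 else 0)) n)
      have e : ∀ t : Fin r → ℕ, Vw q a (r + 1) N (ext0 (Fin.cons n (Fin.cons m t : Fin (r + 1) → ℕ) : Fin (r + 1 + 1) → ℕ))
          = E4 q (((n : ℤ) - m) ^ 2) * qbh q ((N : ℤ) + m + (if r + 1 + 2 = a then 1 else 0)) n *
            Vw q a r n (ext0 (Fin.cons m t : Fin (r + 1) → ℕ)) := by
        intro t
        have e1 : ext0 (Fin.cons n (Fin.cons m t : Fin (r + 1) → ℕ) : Fin (r + 1 + 1) → ℕ) 1 = m :=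
          (ext0_cons_succ _ _ 0).trans (ext0_cons_zero _ _)
        rw [Vw, e1, ext0_cons_zero]
        simp only [ext0_cons_succ]
      simp only [e]
      exact this
    · intro m hm t
      unfold Vw
      simp only [ext0_cons_zero, ext0_cons_succ]
      by_cases hc : Vw q a r n (fun i => ext0 (Fin.cons m t : Fin (r + 1) → ℕ) i) = 0
      · rw [hc, mul_zero]
      · have := Vw_ne a ha _ _ _ hc
        simp only [ext0_cons_zero] at this
        omega

lemma Vw_prod {q : ℝ} (hq0 : 0 < q) (a : ℕ) (r N : ℕ) (f : ℕ → ℕ) (hf : f (r + 1) = 0) :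
    Vw q a r N f = E4 q (∑ i ∈ range (r + 1), ((f i : ℤ) - f (i + 1)) ^ 2) *
      (∏ i ∈ range (r + 1), qbh q (((if i = 0 then N else f (i - 1) : ℕ) : ℤ) + f (i + 1)
        + (if i + a = r + 2 then 1 else 0)) (f i)) *
      (if f r % 2 = (if a = 1 then 0 else 1) then 1 else 0) := by
  induction r generalizing N f with
  | zero =>
    unfold Vw
    have : f 1 = 0 := hf
    simp [this, eq_comm]
  | succ r ih =>
    unfold Vw
    rw [ih (f 0) (fun i => f (i + 1)) hf, sum_range_succ' _ (r + 1), prod_range_succ' _ (r + 1),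
      E4_add hq0]
    have : ∏ i ∈ range (r + 1), qbh q (((if i = 0 then f 0 else f (i - 1 + 1) : ℕ) : ℤ) + f (i + 1 + 1)
        + (if i + a = r + 2 then 1 else 0)) (f (i + 1))
      = ∏ i ∈ range (r + 1), qbh q (((if i + 1 = 0 then N else f (i + 1 - 1) : ℕ) : ℤ) + f (i + 1 + 1)
        + (if i + 1 + a = r + 1 + 2 then 1 else 0)) (f (i + 1)) := by
      apply prod_congr rfl
      intro i _
      have e1 : (if i = 0 then f 0 else f (i - 1 + 1)) = (if i + 1 = 0 then N else f (i + 1 - 1)) := by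
        rw [if_neg (show ¬ i + 1 = 0 by omega)]
        split_ifs with h
        · subst h; rfl
        · congr 1; omega
      have e2 : (i + a = r + 2) = (i + 1 + a = r + 1 + 2) := by apply propext; omega
      rw [e1]; simp only [e2]
    rw [this]
    have e3 : (r + 3 = a) = (0 + a = r + 1 + 2) := by apply propext; omega
    simp only [e3, zero_add, if_true]
    ring

lemma qBinQ_half (q : ℝ) (T : ℤ) (n : ℕ) : qBinQ q ((T : ℚ) / 2) n = qbh q T n := by
  unfold qBinQ qbh
  by_cases hT : T % 2 = 0
  · obtain ⟨s, rfl⟩ : ∃ s, T = 2 * s := ⟨T / 2, by omega⟩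
    rw [if_pos hT, show ((2 * s : ℤ) : ℚ) / 2 = (s : ℚ) by push_cast; ring, show 2 * s / 2 = s by omega]
    unfold qb
    have e : ((s : ℚ).den = 1 ∧ (n : ℚ) ≤ (s : ℚ)) ↔ (0 ≤ (n : ℤ) ∧ (n : ℤ) ≤ s) := by
      simp only [Rat.den_intCast, true_and]
      constructor
      · intro h; exact ⟨by positivity, by exact_mod_cast h⟩
      · intro h; exact_mod_cast h.2
    by_cases h : 0 ≤ (n : ℤ) ∧ (n : ℤ) ≤ s
    · rw [if_pos h, if_pos (e.2 h), Rat.num_intCast]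
      congr 3
      omega
    · rw [if_neg h, if_neg (fun h' => h (e.1 h'))]
  · rw [if_neg hT, if_neg]
    rintro ⟨h1, _⟩
    have h2 := Rat.coe_int_num_of_den_eq_one h1
    have h3 : (T : ℚ) = 2 * (((T : ℚ) / 2).num : ℚ) := by rw [h2]; ring
    have h4 : T = 2 * ((T : ℚ) / 2).num := by exact_mod_cast h3
    omega

/-- action of the incidence matrix -/
def Iact (M : ℕ → ℕ) (i : ℕ) : ℤ :=
  if i = 0 then -(M 2 : ℤ) else if i = 1 then M 2 else if i = 2 then (M 0 : ℤ) + M 1 + M 3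
    else (M (i - 1) : ℤ) + M (i + 1)

lemma sum_pick (M : ℕ → ℕ) (K c : ℕ) (h : ∀ i, K ≤ i → M i = 0) :
    ∑ j ∈ range K, (if j = c then (1 : ℚ) else 0) * (M j : ℚ) = M c := by
  by_cases hc : c < K
  · rw [sum_eq_single c]
    · simp
    · intro b _ hb; rw [if_neg hb, zero_mul]
    · intro h; exact absurd (mem_range.2 hc) h
  · rw [h c (by omega)]
    simp only [Nat.cast_zero]
    apply sum_eq_zero
    intro j hj
    rw [mem_range] at hj
    rw [if_neg (by omega), zero_mul]

lemma Iact_eq (k : ℕ) (m : Fin (k + 4 - 1) → ℕ) (i : Fin (k + 4 - 1)) :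
    ∑ j, ItM (k + 4) i j * (m j : ℚ) = (Iact (ext0 m) i.val : ℚ) := by
  have hz : ∀ i, k + 4 - 1 ≤ i → ext0 m i = 0 := fun i hi => ext0_ge m hi
  have h1 : ∀ c : ℕ → ℚ, (∀ j : Fin (k + 4 - 1), ItM (k + 4) i j = c j.val) →
      ∑ j, ItM (k + 4) i j * (m j : ℚ) = ∑ j ∈ range (k + 4 - 1), c j * (ext0 m j : ℚ) := by
    intro c hc
    rw [← Fin.sum_univ_eq_sum_range (fun j => c j * (ext0 m j : ℚ))]
    apply sum_congr rfl
    intro j _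
    rw [hc, ext0_fin]
  unfold Iact
  by_cases i0 : i.val = 0
  · rw [h1 (fun j => -(if j = 2 then 1 else 0)), if_pos i0]
    · simp only [neg_mul, sum_neg_distrib]
      rw [sum_pick _ _ _ hz]; push_cast; rfl
    · intro j; unfold ItM; rw [if_pos i0]; split_ifs <;> norm_num
  by_cases i1 : i.val = 1
  · rw [h1 (fun j => (if j = 2 then 1 else 0)), if_neg i0, if_pos i1]
    · rw [sum_pick _ _ _ hz]; push_cast; rfl
    · intro j; unfold ItM; rw [if_neg i0]; split_ifs <;> first | rfl | omega
  by_cases i2 : i.val = 2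
  · rw [h1 (fun j => (if j = 0 then 1 else 0) + (if j = 1 then 1 else 0) + (if j = 3 then 1 else 0)), if_neg i0, if_neg i1,
      if_pos i2]
    · simp only [add_mul, sum_add_distrib]
      rw [sum_pick _ _ _ hz, sum_pick _ _ _ hz, sum_pick _ _ _ hz]; push_cast; rfl
    · intro j; unfold ItM; rw [if_neg i0]; split_ifs <;> first | omega | norm_num
  · rw [h1 (fun j => (if j = i.val - 1 then 1 else 0) + (if j = i.val + 1 then 1 else 0)), if_neg i0, if_neg i1,
      if_neg i2]
    · simp only [add_mul, sum_add_distrib]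
      rw [sum_pick _ _ _ hz, sum_pick _ _ _ hz]; push_cast; rfl
    · intro j; unfold ItM; rw [if_neg i0]; split_ifs <;> first | omega | norm_num

lemma quad_chain (f : ℕ → ℤ) (k : ℕ) :
    ∑ i ∈ range k, f (i + 1) * (2 * f (i + 1) - (f i + f (i + 2))) + f 0 * (f 0 - f 1)
      = ∑ i ∈ range k, (f i - f (i + 1)) ^ 2 + f k * (f k - f (k + 1)) := by
  induction k with
  | zero => simp
  | succ k ih =>
    rw [sum_range_succ, sum_range_succ]
    linear_combination ih

lemma quad_eq (k : ℕ) (m : Fin (k + 4 - 1) → ℕ) :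
    ∑ i, ∑ j, (m i : ℚ) * CtM (k + 4) i j * (m j : ℚ) =
      ((2 * (ext0 m 0 : ℤ) ^ 2 + 2 * (ext0 m 1 : ℤ) ^ 2 - 2 * ext0 m 1 * ext0 m 2 + (ext0 m 2 : ℤ) ^ 2
        + ∑ i ∈ range (k + 1), ((ext0 m (i + 2) : ℤ) - ext0 m (i + 3)) ^ 2 : ℤ) : ℚ) := by
  have h1 : ∀ i : Fin (k + 4 - 1), ∑ j, (m i : ℚ) * CtM (k + 4) i j * (m j : ℚ) =
      (((ext0 m i.val : ℤ) * (2 * ext0 m i.val - Iact (ext0 m) i.val) : ℤ) : ℚ) := by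
    intro i
    have : ∀ j, (m i : ℚ) * CtM (k + 4) i j * (m j : ℚ)
      = (if i = j then 2 * (m i : ℚ) * m j else 0) - (m i : ℚ) * (ItM (k + 4) i j * m j) := by
      intro j; unfold CtM; split_ifs <;> ring
    rw [sum_congr rfl fun j _ => this j, sum_sub_distrib, ← mul_sum, Iact_eq, sum_ite_eq, if_pos (mem_univ _),
      ext0_fin]
    push_cast; ring
  rw [sum_congr rfl fun i _ => h1 i, ← Int.cast_sum,
    Fin.sum_univ_eq_sum_range (fun i => (ext0 m i : ℤ) * (2 * ext0 m i - Iact (ext0 m) i))]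
  congr 1
  have hz : ext0 m (k + 3) = 0 := ext0_ge m (le_refl _)
  have hc := quad_chain (fun i => (ext0 m (i + 2) : ℤ)) k
  simp only [zero_add] at hc
  generalize ext0 m = M at hz hc ⊢
  rw [show k + 4 - 1 = k + 1 + 1 + 1 from rfl, sum_range_succ', sum_range_succ', sum_range_succ', sum_range_succ]
  have e : ∀ i ∈ range k, ((M (i + 1 + 1 + 1) : ℤ) * (2 * M (i + 1 + 1 + 1) - Iact (M) (i + 1 + 1 + 1)))
      = M (i + 1 + 2) * (2 * M (i + 1 + 2) - (M (i + 2) + M (i + 2 + 2))) := by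
    intro i _
    unfold Iact
    rw [if_neg (by omega), if_neg (by omega), if_neg (by omega)]
    rfl
  rw [sum_congr rfl e]
  have e0 : Iact (M) 0 = -(M 2 : ℤ) := rfl
  have e1 : Iact (M) (0 + 1) = (M 2 : ℤ) := rfl
  have e2 : Iact (M) (0 + 1 + 1) = (M 0 : ℤ) + M 1 + M 3 := rfl
  rw [e0, e1, e2]
  simp only [show ∀ i, i + 1 + 2 = i + 3 from fun i => rfl, hz, zero_add] at hc ⊢
  simp only [show (1 + 1 : ℕ) = 2 from rfl, show (1 + 2 : ℕ) = 3 from rfl] at hc ⊢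
  push_cast at hc ⊢
  linear_combination hc

/-- weight of the first three variables -/
def Gw (q : ℝ) (L : ℕ) (e : ℤ) (m0 m1 m2 : ℕ) : ℝ :=
  E4 q (2 * (m0 : ℤ) ^ 2 + 2 * (m1 : ℤ) ^ 2 - 2 * m1 * m2 - 2 * e * m1 + (m2 : ℤ) ^ 2) *
    qbh q (2 * (L : ℤ) - m2 - e) m0 * qbh q ((m2 : ℤ) + e) m1

/-- integer version of the vector `u` -/
def Uf (k a : ℕ) (e : ℤ) (i : ℕ) : ℤ :=
  (if i + a = k + 4 then 1 else 0) + e * ((if i = 1 then 1 else 0) - (if i = 0 then 1 else 0))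

lemma summand_eq {q : ℝ} (hq0 : 0 < q) (k a κ L : ℕ) (e : ℤ) (ha2 : a ≤ k + 2)
    (u A : Fin (k + 4 - 1) → ℚ) (hu : ∀ j, u j = (Uf k a e j.val : ℚ))
    (hA : ∀ j, A j = (e : ℚ) * (if j.val = 1 then 1 else 0))
    (hκ : κ % 2 = if a = 1 then 0 else 1) (m : Fin (k + 4 - 1) → ℕ) :
    (if mlast (k + 4) m % 2 = κ % 2 then
      q ^ ((PhiQ (k + 4) A m : ℝ)) * ∏ i, qBinQ q (topVec (k + 4) L u m i) (m i)
    else 0) = Gw q L e (ext0 m 0) (ext0 m 1) (ext0 m 2) *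
      Vw q a k (ext0 m 0 + ext0 m 1) (fun i => ext0 m (i + 2)) := by
  have hz : ∀ i, k + 4 - 1 ≤ i → ext0 m i = 0 := fun i hi => ext0_ge m hi
  have hl : mlast (k + 4) m = ext0 m (k + 2) := by
    unfold mlast
    rw [dif_pos (by omega)]
    exact (ext0_fin m ⟨k + 4 - 2, by omega⟩).symm
  have hPhi : PhiQ (k + 4) A m = ((2 * (ext0 m 0 : ℤ) ^ 2 + 2 * (ext0 m 1 : ℤ) ^ 2 - 2 * ext0 m 1 * ext0 m 2
        - 2 * e * ext0 m 1 + (ext0 m 2 : ℤ) ^ 2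
        + ∑ i ∈ range (k + 1), ((ext0 m (i + 2) : ℤ) - ext0 m (i + 3)) ^ 2 : ℤ) : ℚ) / 4 := by
    unfold PhiQ
    rw [quad_eq]
    have : ∑ j, A j * (m j : ℚ) = e * ext0 m 1 := by
      rw [← sum_pick (ext0 m) (k + 4 - 1) 1 hz, ← Fin.sum_univ_eq_sum_range
        (fun j => (if j = 1 then (1 : ℚ) else 0) * (ext0 m j : ℚ)), mul_sum]
      apply sum_congr rfl
      intro j _
      rw [hA, ext0_fin]; ring
    rw [this]
    push_cast; ring
  have hE : q ^ ((PhiQ (k + 4) A m : ℝ)) = E4 q (2 * (ext0 m 0 : ℤ) ^ 2 + 2 * (ext0 m 1 : ℤ) ^ 2 - 2 * ext0 m 1 * ext0 m 2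
        - 2 * e * ext0 m 1 + (ext0 m 2 : ℤ) ^ 2
        + ∑ i ∈ range (k + 1), ((ext0 m (i + 2) : ℤ) - ext0 m (i + 3)) ^ 2) := by
    unfold E4
    rw [hPhi]
    congr 1
    rw [Rat.cast_div, Rat.cast_intCast, Rat.cast_ofNat]
  have hT : ∀ i : Fin (k + 4 - 1), qBinQ q (topVec (k + 4) L u m i) (m i)
      = qbh q (Iact (ext0 m) i.val + 2 * L * (if i.val = 0 then 1 else 0) + Uf k a e i.val) (ext0 m i.val) := by
    intro i
    rw [ext0_fin, ← qBinQ_half]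
    congr 1
    unfold topVec evec
    rw [Iact_eq, hu]
    push_cast
    ring
  rw [hl, hE, prod_congr rfl fun i _ => hT i, Fin.prod_univ_eq_prod_range (fun i =>
    qbh q (Iact (ext0 m) i + 2 * L * (if i = 0 then 1 else 0) + Uf k a e i) (ext0 m i)),
    Vw_prod hq0 a k (ext0 m 0 + ext0 m 1) (fun i => ext0 m (i + 2)) (hz (k + 1 + 2) (by omega)), hκ]
  generalize ext0 m = M at hz ⊢
  rw [show k + 4 - 1 = k + 1 + 1 + 1 from rfl, prod_range_succ', prod_range_succ', E4_add hq0]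
  have e0 : Iact M 0 + 2 * L * (if 0 = 0 then 1 else 0) + Uf k a e 0 = 2 * (L : ℤ) - M 2 - e := by
    simp only [Iact, Uf, if_true]
    rw [if_neg (by omega)]; norm_num; ring
  have e1 : Iact M (0 + 1) + 2 * L * (if 0 + 1 = 0 then 1 else 0) + Uf k a e (0 + 1) = (M 2 : ℤ) + e := by
    have h3 : ¬ (1 + a = k + 4) := by omega
    simp [Iact, Uf, h3]
  have e2 : ∀ i ∈ range (k + 1), qbh q (Iact M (i + 1 + 1) + 2 * L * (if i + 1 + 1 = 0 then 1 else 0) + Uf k a e (i + 1 + 1)) (M (i + 1 + 1))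
      = qbh q (((if i = 0 then M 0 + M 1 else M (i - 1 + 2) : ℕ) : ℤ) + M (i + 1 + 2)
        + (if i + a = k + 2 then 1 else 0)) (M (i + 2)) := by
    intro i _
    congr 1
    simp only [Iact, Uf]
    rw [if_neg (show ¬ i + 1 + 1 = 0 by omega), if_neg (show ¬ i + 1 + 1 = 1 by omega),
      if_neg (show ¬ i + 1 + 1 = 0 by omega), if_neg (show ¬ i + 1 + 1 = 1 by omega)]
    have e3 : (i + 1 + 1 + a = k + 4) = (i + a = k + 2) := by apply propext; omega
    simp only [e3]
    by_cases hi : i = 0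
    · subst hi; simp
    · rw [if_neg (by omega), if_neg hi, show i + 1 + 1 - 1 = i - 1 + 2 by omega]
      simp
  rw [prod_congr rfl e2, e0, e1]
  unfold Gw
  split_ifs <;> simp <;> ring

lemma Gw_ne {q : ℝ} {L : ℕ} {e : ℤ} (he0 : 0 ≤ e) {m0 m1 m2 : ℕ} (h : Gw q L e m0 m1 m2 ≠ 0) :
    m0 ≤ L ∧ m1 ≤ L := by
  unfold Gw at h
  have h1 := qbh_ne (right_ne_zero_of_mul h)
  have h2 := qbh_ne (right_ne_zero_of_mul (left_ne_zero_of_mul h))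
  omega

lemma ferm_hasSum {q : ℝ} (k a L : ℕ) (e : ℤ) (ha : 1 ≤ a) (he0 : 0 ≤ e) :
    HasSum (fun m : Fin (k + 1 + 1 + 1) → ℕ => Gw q L e (ext0 m 0) (ext0 m 1) (ext0 m 2) *
      Vw q a k (ext0 m 0 + ext0 m 1) (fun i => ext0 m (i + 2)))
    (∑ m0 ∈ range (L + 1), ∑ m1 ∈ range (L + 1), ∑ m2 ∈ range (m0 + m1 + 1),
      Gw q L e m0 m1 m2 * Yc q a (k + 1) (m0 + m1) m2) := by
  have ev : ∀ (m0 m1 : ℕ) (t : Fin (k + 1) → ℕ),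
      Gw q L e (ext0 (Fin.cons m0 (Fin.cons m1 t : Fin (k + 1 + 1) → ℕ) : Fin (k + 1 + 1 + 1) → ℕ) 0)
        (ext0 (Fin.cons m0 (Fin.cons m1 t : Fin (k + 1 + 1) → ℕ) : Fin (k + 1 + 1 + 1) → ℕ) 1)
        (ext0 (Fin.cons m0 (Fin.cons m1 t : Fin (k + 1 + 1) → ℕ) : Fin (k + 1 + 1 + 1) → ℕ) 2) *
      Vw q a k (ext0 (Fin.cons m0 (Fin.cons m1 t : Fin (k + 1 + 1) → ℕ) : Fin (k + 1 + 1 + 1) → ℕ) 0 +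
        ext0 (Fin.cons m0 (Fin.cons m1 t : Fin (k + 1 + 1) → ℕ) : Fin (k + 1 + 1 + 1) → ℕ) 1)
        (fun i => ext0 (Fin.cons m0 (Fin.cons m1 t : Fin (k + 1 + 1) → ℕ) : Fin (k + 1 + 1 + 1) → ℕ) (i + 2))
      = Gw q L e m0 m1 (ext0 t 0) * Vw q a k (m0 + m1) (ext0 t) := by
    intro m0 m1 t
    have h0 : ext0 (Fin.cons m0 (Fin.cons m1 t : Fin (k + 1 + 1) → ℕ) : Fin (k + 1 + 1 + 1) → ℕ) 0 = m0 :=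
      ext0_cons_zero _ _
    have h1 : ext0 (Fin.cons m0 (Fin.cons m1 t : Fin (k + 1 + 1) → ℕ) : Fin (k + 1 + 1 + 1) → ℕ) 1 = m1 :=
      (ext0_cons_succ _ _ 0).trans (ext0_cons_zero _ _)
    have h2 : ∀ i, ext0 (Fin.cons m0 (Fin.cons m1 t : Fin (k + 1 + 1) → ℕ) : Fin (k + 1 + 1 + 1) → ℕ) (i + 2) = ext0 t i :=
      fun i => (ext0_cons_succ _ _ (i + 1)).trans (ext0_cons_succ _ _ i)
    have h3 := h2 0
    rw [zero_add] at h3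
    simp only [h0, h1, h2]
  apply hasSum_cons
  · intro m0
    apply hasSum_cons
    · intro m1
      simp only [ev]
      apply hasSum_cons
      · intro m2
        simp only [ext0_cons_zero]
        exact (Vw_hasSum a ha k (m0 + m1) m2).mul_left _
      · intro m2 hm t
        by_contra hc
        have := Vw_ne a ha _ _ _ (right_ne_zero_of_mul hc)
        rw [ext0_cons_zero] at this
        omega
    · intro m1 hm t
      rw [ev]
      by_contra hc
      have := Gw_ne he0 (left_ne_zero_of_mul hc)
      omega
  · intro m0 hm t
    rw [← Fin.cons_self_tail t, ev]
    by_contra hc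
    have := Gw_ne he0 (left_ne_zero_of_mul hc)
    omega

lemma vdm_claim {q : ℝ} (hq0 : 0 < q) (hq1 : q < 1) (L n m2 : ℕ) (e : ℤ) (he0 : 0 ≤ e) (he1 : e ≤ 1)
    (hm : m2 ≤ n) (hp : ((m2 : ℤ) + e) % 2 = 0) :
    ∑ m1 ∈ range (L + 1), (if m1 ≤ n then Gw q L e (n - m1) m1 m2 else 0)
      = qb q L n * E4 q ((n : ℤ) ^ 2 - 2 * n * e) * E4 q (((n : ℤ) - m2) ^ 2) := by
  obtain ⟨x, hx⟩ : ∃ x : ℕ, (m2 : ℤ) + e = 2 * x := ⟨(((m2 : ℤ) + e) / 2).toNat, by omega⟩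
  have hG : ∀ m1 ∈ range (L + 1), (if m1 ≤ n then Gw q L e (n - m1) m1 m2 else 0)
      = E4 q ((n : ℤ) ^ 2 - 2 * n * e) * E4 q (((n : ℤ) - m2) ^ 2) *
        (q ^ (((n : ℤ) - m1) * (x - m1)) * qb q x m1 * qb q ((L : ℤ) - x) (n - m1)) := by
    intro m1 _
    split_ifs with h
    · unfold Gw qbh
      rw [Nat.cast_sub h, hx, if_pos (by omega), if_pos (by omega), show 2 * (x : ℤ) / 2 = x by omega,
        show (2 * (L : ℤ) - m2 - e) / 2 = L - x by omega, ← E4_four, ← E4_add hq0]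
      have : 2 * ((n : ℤ) - m1) ^ 2 + 2 * (m1 : ℤ) ^ 2 - 2 * m1 * m2 - 2 * e * m1 + (m2 : ℤ) ^ 2
        = ((n : ℤ) ^ 2 - 2 * n * e + ((n : ℤ) - m2) ^ 2) + 4 * (((n : ℤ) - m1) * (x - m1)) := by
        linear_combination (2 * (n : ℤ) - 2 * m1) * hx
      rw [this, E4_add hq0 (_ + _)]
      ring
    · rw [qb_of_neg q (show (n : ℤ) - m1 < 0 by omega)]; ring
  rw [sum_congr rfl hG, ← mul_sum]
  by_cases hxL : x ≤ L
  · have h1 : ∑ m1 ∈ range (L + 1), q ^ (((n : ℤ) - m1) * (x - m1)) * qb q x m1 * qb q ((L : ℤ) - x) (n - m1)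
        = ∑ m1 ∈ range (x + 1), q ^ (((n : ℤ) - m1) * (x - m1)) * qb q x m1 * qb q ((L : ℤ) - x) (n - m1) := by
      symm
      apply sum_subset
      · intro i; simp only [mem_range]; omega
      · intro i _ hi
        simp only [mem_range] at hi
        rw [qb_of_lt q (show (x : ℤ) < i by omega)]; ring
    have h2 := qb_vdm hq0 hq1 x ((L : ℤ) - x) (by omega) ((n : ℤ) - x)
    rw [show (x : ℤ) + (L - x) = L by ring, show (x : ℤ) + (n - x) = n by ring] at h2
    have h5 : ∑ m1 ∈ range (x + 1), q ^ (((n : ℤ) - m1) * (x - m1)) * qb q x m1 * qb q ((L : ℤ) - x) (n - m1)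
        = qb q L n := by
      rw [← h2, ← sum_range_reflect]
      apply sum_congr rfl
      intro r hr
      rw [mem_range] at hr
      rw [show x + 1 - 1 - r = x - r by omega, Nat.cast_sub (by omega), qb_symm,
        show (n : ℤ) - (x - r) = r + (n - x) by ring, show (x : ℤ) - (x - r) = r by ring, mul_comm (r : ℤ)]
    rw [h1, h5]
    ring
  · rw [sum_eq_zero]
    · rw [qb_of_lt q (show (L : ℤ) < n by omega)]; ring
    · intro m1 _
      have : qb q ((L : ℤ) - x) (n - m1) = 0 := by
        by_contra hc
        have := qb_ne hc
        omega
      rw [this, mul_zero]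

lemma regroup (H : ℕ → ℕ → ℝ) (L : ℕ) (h0 : ∀ i j, L < i → H i j = 0) :
    ∑ i ∈ range (L + 1), ∑ j ∈ range (L + 1), H i j
      = ∑ n ∈ range (2 * L + 1), ∑ j ∈ range (L + 1), if j ≤ n then H (n - j) j else 0 := by
  rw [sum_comm]
  conv_rhs => rw [sum_comm]
  apply sum_congr rfl
  intro j hj
  rw [mem_range] at hj
  rw [← sum_filter]
  have h1 : ∑ i ∈ range (L + 1), H i j = ∑ i ∈ range (2 * L + 1 - j), H i j := by
    apply sum_subset
    · intro i; simp only [mem_range]; omega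
    · intro i _ hi; simp only [mem_range] at hi; exact h0 i j (by omega)
  rw [h1]
  apply sum_nbij' (fun i => i + j) (fun n => n - j)
  · intro i; simp only [mem_range, mem_filter]; omega
  · intro i; simp only [mem_range, mem_filter]; omega
  · intro i; simp
  · intro i; simp only [mem_range, mem_filter]; omega
  · intro i _; simp

lemma ferm_final {q : ℝ} (hq0 : 0 < q) (hq1 : q < 1) (k a L : ℕ) (e : ℤ) (ha : 1 ≤ a) (ha2 : a ≤ k + 2)
    (he0 : 0 ≤ e) (he1 : e ≤ 1) (hea : ((a : ℤ) + e) % 2 = 1) :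
    ∑ m0 ∈ range (L + 1), ∑ m1 ∈ range (L + 1), ∑ m2 ∈ range (m0 + m1 + 1),
      Gw q L e m0 m1 m2 * Yc q a (k + 1) (m0 + m1) m2 = Sform q ((k + 4 : ℕ) : ℤ) a e L ((L + 2 : ℕ) : ℤ) := by
  rw [regroup (fun m0 m1 => ∑ m2 ∈ range (m0 + m1 + 1), Gw q L e m0 m1 m2 * Yc q a (k + 1) (m0 + m1) m2)]
  · have h1 : ∀ n ∈ range (2 * L + 1), (∑ m1 ∈ range (L + 1), if m1 ≤ n then
        ∑ m2 ∈ range (n - m1 + m1 + 1), Gw q L e (n - m1) m1 m2 * Yc q a (k + 1) (n - m1 + m1) m2 else 0)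
        = qb q L n * E4 q ((n : ℤ) ^ 2 - 2 * n * e) *
          ∑ m2 ∈ range (n + 1), E4 q (((n : ℤ) - m2) ^ 2) * Yc q a (k + 1) n m2 := by
      intro n _
      have h2 : ∀ m1 ∈ range (L + 1), (if m1 ≤ n then
        ∑ m2 ∈ range (n - m1 + m1 + 1), Gw q L e (n - m1) m1 m2 * Yc q a (k + 1) (n - m1 + m1) m2 else 0)
        = ∑ m2 ∈ range (n + 1), (if m1 ≤ n then Gw q L e (n - m1) m1 m2 else 0) * Yc q a (k + 1) n m2 := by
        intro m1 _
        split_ifs with h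
        · rw [Nat.sub_add_cancel h]
        · simp
      rw [sum_congr rfl h2, sum_comm, mul_sum]
      apply sum_congr rfl
      intro m2 hm
      rw [mem_range] at hm
      rw [← sum_mul]
      by_cases hY : Yc q a (k + 1) n m2 = 0
      · rw [hY]; ring
      · have := Yout_zero a ha (k + 1) (by omega) n m2 hY
        rw [vdm_claim hq0 hq1 L n m2 e he0 he1 (by omega) (by omega)]
        ring
    rw [sum_congr rfl h1]
    unfold Sform
    symm
    have h3 : ∀ n ∈ range (L + 1), qb q L n * E4 q ((n : ℤ) ^ 2 - 2 * n * e) *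
        (if ((n : ℤ) + a) % 2 = 1 then ∑ j ∈ Ico (-((L + 2 : ℕ) : ℤ)) ((L + 2 : ℕ) : ℤ),
        E4 q (4 * ((k + 4 : ℕ) : ℤ) * j ^ 2 + 4 * a * j + (a - 1)) *
        (qb q n ((n + (2 * ((k + 4 : ℕ) : ℤ) * j + a - 1)) / 2) - qb q n ((n + (2 * ((k + 4 : ℕ) : ℤ) * j + a + 1)) / 2))
      else 0) = qb q L n * E4 q ((n : ℤ) ^ 2 - 2 * n * e) *
          ∑ m2 ∈ range (n + 1), E4 q (((n : ℤ) - m2) ^ 2) * Yc q a (k + 1) n m2 := by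
      intro n hn
      rw [mem_range] at hn
      congr 1
      rw [Yinf hq0 hq1 a ha (k + 1) (by omega) n (L + 2) (by omega),
        show ((k + 1 : ℕ) : ℤ) + 3 = ((k + 4 : ℕ) : ℤ) by push_cast; ring]
      have e3 : (((n : ℤ) + a) % 2 = 1) = ((n + a) % 2 = 1) := by apply propext; omega
      simp only [e3]
    rw [sum_congr rfl h3]
    apply sum_subset
    · intro i; simp only [mem_range]; omega
    · intro i _ hi
      simp only [mem_range] at hi
      rw [qb_of_lt q (show (L : ℤ) < i by omega)]; ring
  · intro i j hi
    apply sum_eq_zero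
    intro m2 _
    by_cases hG : Gw q L e i j m2 = 0
    · rw [hG, zero_mul]
    · have := Gw_ne he0 hG; omega

lemma fFerm_eq {q : ℝ} (hq0 : 0 < q) (hq1 : q < 1) (k a κ L : ℕ) (e : ℤ) (ha : 1 ≤ a) (ha2 : a ≤ k + 2)
    (he0 : 0 ≤ e) (he1 : e ≤ 1) (hea : ((a : ℤ) + e) % 2 = 1)
    (u A : Fin (k + 4 - 1) → ℚ) (hu : ∀ j, u j = (Uf k a e j.val : ℚ))
    (hA : ∀ j, A j = (e : ℚ) * (if j.val = 1 then 1 else 0))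
    (hκ : κ % 2 = if a = 1 then 0 else 1) :
    fFerm q (k + 4) κ L u A = Sform q ((k + 4 : ℕ) : ℤ) a e L ((L + 2 : ℕ) : ℤ) := by
  unfold fFerm
  simp only [summand_eq hq0 k a κ L e ha2 u A hu hA hκ]
  rw [← ferm_final hq0 hq1 k a L e ha ha2 he0 he1 hea]
  exact (ferm_hasSum k a L e ha he0).tsum_eq

lemma F_eq {q : ℝ} (hq0 : 0 < q) (hq1 : q < 1) (k a L : ℕ) (e : ℤ) (ha : 1 ≤ a) (ha2 : a ≤ k + 2)
    (he0 : 0 ≤ e) (he1 : e ≤ 1) (hea : ((a : ℤ) + e) % 2 = 1) :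
    (if a = 1 then Fpoly q (k + 4) 0 1 1 L else Fpoly q (k + 4) 1 (k + 4 - a) 1 L)
      = Sform q ((k + 4 : ℕ) : ℤ) a e L ((L + 2 : ℕ) : ℤ) := by
  have hcase : e = 0 ∨ e = 1 := by omega
  split_ifs with h1
  · subst h1
    obtain rfl : e = 0 := by omega
    unfold Fpoly
    rw [if_neg (by omega)]
    apply fFerm_eq hq0 hq1 k 1 0 L 0 ha ha2 he0 he1 hea
    · intro j
      have := j.isLt
      unfold uvec Uf ptil kdel
      rw [if_neg (show ¬ j.val + 1 = k + 4 by omega)]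
      norm_num
    · intro j
      unfold Avec ptil kdel
      norm_num
    · rfl
  · unfold Fpoly
    rw [if_neg (by omega)]
    have hpt : ptil (k + 4 - a + kdel (k + 4 - a) 1 + 1 + kdel 1 1 + (if 1 = 1 then k + 4 - 1 else 0)) = (e : ℚ) := by
      unfold ptil kdel
      rw [if_neg (show ¬ k + 4 - a = 1 by omega), if_pos rfl, if_pos rfl]
      rcases hcase with rfl | rfl
      · rw [if_neg (by omega)]; norm_num
      · rw [if_pos (by omega)]; norm_num
    apply fFerm_eq hq0 hq1 k a 1 L e ha ha2 he0 he1 hea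
    · intro j
      unfold uvec Uf
      rw [hpt, if_pos (by omega), if_neg (by omega)]
      unfold evec
      have e3 : (j.val + a = k + 4) = (j.val = k + 4 - a) := by apply propext; omega
      simp only [e3]
      push_cast
      ring
    · intro j
      unfold Avec
      rw [hpt, if_neg (by omega)]
      unfold evec
      ring
    · rw [if_neg h1]

/-- For `p ≥ 4`, `1 ≤ a ≤ p-2`, `L ≥ 0` and `0 < q < 1`:
if `a` is odd then `F^{p,1}_{p-a,1}(L) = q^{φ(p-a,p-1)} B^p_{a,1}(L,1)`,
and if `a` is even then `F^{p,1}_{p-a,1}(L) = q^{φ̃(p-a,p-1)+1-a} B^p_{a,1}(L,2)`;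
here, by convention, `F^{p,1}_{p-1,b}(L) ≡ F^{p,0}_{1,b}(L)`. -/
theorem odd_identity_b_eq_one (p a : ℕ) (hp : 4 ≤ p) (ha1 : 1 ≤ a) (ha2 : a ≤ p - 2)
    (L : ℕ) (q : ℝ) (hq0 : 0 < q) (hq1 : q < 1) :
    (a % 2 = 1 →
      (if a = 1 then Fpoly q p 0 1 1 L else Fpoly q p 1 (p - a) 1 L)
        = q ^ (phiR ((p : ℝ) - (a : ℝ)) ((p : ℝ) - 1)) * Bpoly q p a 1 1 L) ∧
    (a % 2 = 0 →
      (if a = 1 then Fpoly q p 0 1 1 L else Fpoly q p 1 (p - a) 1 L)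
        = q ^ (phitR ((p : ℝ) - (a : ℝ)) ((p : ℝ) - 1) + 1 - (a : ℝ)) * Bpoly q p a 1 2 L) := by
  obtain ⟨k, rfl⟩ : ∃ k, p = k + 4 := ⟨p - 4, by omega⟩
  constructor
  · intro h
    rw [F_eq hq0 hq1 k a L 0 ha1 (by omega) (by omega) (by omega) (by omega),
      ← bos_odd hq0 hq1 ((k + 4 : ℕ) : ℤ) (a : ℤ) (by omega) (by omega) (by omega) L
        ((L + 2 : ℕ) : ℤ) (by omega)]
    congr 1
    unfold phiR E4
    congr 1
    push_cast
    ring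
  · intro h
    rw [F_eq hq0 hq1 k a L 1 ha1 (by omega) (by omega) (by omega) (by omega),
      ← bos_even hq0 hq1 ((k + 4 : ℕ) : ℤ) (a : ℤ) (by omega) (by omega) (by omega) L
        ((L + 2 : ℕ) : ℤ) (by omega)]
    congr 1
    unfold phitR E4
    congr 1
    push_cast
    ring
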